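/- Let μ₀ ∈ SP and assume there exists a weakly continuous solution (Γ_t)_{t∈[0,T]} to (SP-CE) with initial condition Γ₀ = δ_{μ₀}. Then there exists a subprobability solution to (NLFPK) with initial condition μ₀. Moreover, if μ₀ ∈ P, then there exists a probability solution to (NLFPK) with initial condition μ₀. -/

import Mathlib

open MeasureTheory Topology Filter

noncomputable section

/-- Euclidean space `ℝ^d`. -/
abbrev Rd (d : ℕ) := Fin d → ℝ

/-- The space of subprobability measures on `ℝ^d`. -/
def SP (d : ℕ) : Type := {μ : Measure (Rd d) // μ Set.univ ≤ 1}

/-- The vague topology on `SP d`: the initial topology of the maps `μ ↦ ∫ g dμ` for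
`g : ℝ^d → ℝ` continuous with compact support. -/
instance (d : ℕ) : TopologicalSpace (SP d) :=
  ⨅ g : {g : Rd d → ℝ // Continuous g ∧ HasCompactSupport g},
    TopologicalSpace.induced (fun μ : SP d => ∫ x, g.1 x ∂μ.1) inferInstance

instance (d : ℕ) : MeasurableSpace (SP d) := borel (SP d)
instance (d : ℕ) : BorelSpace (SP d) := ⟨rfl⟩

/-- First-order partial derivative `∂_i f`. -/
def pd {n : ℕ} (f : (Fin n → ℝ) → ℝ) (i : Fin n) (x : Fin n → ℝ) : ℝ :=
  fderiv ℝ f x (Pi.single i 1)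

/-- Second-order partial derivative `∂²_{ij} f`. -/
def pd2 {n : ℕ} (f : (Fin n → ℝ) → ℝ) (i j : Fin n) (x : Fin n → ℝ) : ℝ :=
  fderiv ℝ (fun y => pd f j y) x (Pi.single i 1)

/-- Twice continuously differentiable with compact support. -/
def IsC2c {n : ℕ} (φ : (Fin n → ℝ) → ℝ) : Prop :=
  ContDiff ℝ 2 φ ∧ HasCompactSupport φ

/-- Twice continuously differentiable, bounded, with bounded first and second order
partial derivatives. -/
def IsC2b {n : ℕ} (f : (Fin n → ℝ) → ℝ) : Prop :=
  ContDiff ℝ 2 f ∧ ∃ M : ℝ, ∀ x, |f x| ≤ M ∧ (∀ i, |pd f i x| ≤ M) ∧ ∀ i j, |pd2 f i j x| ≤ M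

/-- Borel coefficients, with `a` symmetric and positive semidefinite (`S⁺_d`-valued). -/
def GoodCoeffs (d : ℕ) (a : ℝ → SP d → Rd d → Fin d → Fin d → ℝ)
    (b : ℝ → SP d → Rd d → Fin d → ℝ) : Prop :=
  (∀ i j, Measurable fun p : ℝ × SP d × Rd d => a p.1 p.2.1 p.2.2 i j) ∧
  (∀ i, Measurable fun p : ℝ × SP d × Rd d => b p.1 p.2.1 p.2.2 i) ∧
  (∀ t μ x i j, a t μ x i j = a t μ x j i) ∧
  (∀ t μ x (v : Fin d → ℝ), 0 ≤ ∑ i, ∑ j, v i * a t μ x i j * v j)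

/-- The Kolmogorov operator `L_{t,μ}φ = ∑ a_ij ∂²_ij φ + ∑ b_i ∂_i φ`. -/
def Lop {d : ℕ} (a : ℝ → SP d → Rd d → Fin d → Fin d → ℝ)
    (b : ℝ → SP d → Rd d → Fin d → ℝ) (t : ℝ) (μ : SP d) (φ : Rd d → ℝ) (x : Rd d) : ℝ :=
  (∑ i, ∑ j, a t μ x i j * pd2 φ i j x) + ∑ i, b t μ x i * pd φ i x

/-- Global integrability condition for (NLFPK). -/
def NLFPKIntegrable (d : ℕ) (T : ℝ) (a : ℝ → SP d → Rd d → Fin d → Fin d → ℝ)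
    (b : ℝ → SP d → Rd d → Fin d → ℝ) (μ : ℝ → SP d) : Prop :=
  ∀ i j, ∫⁻ t in Set.Ioc (0:ℝ) T,
      ∫⁻ x, ENNReal.ofReal (|a t (μ t) x i j| + |b t (μ t) x i|) ∂(μ t).1 < ⊤

/-- The weak form of the nonlinear FPK equation, tested against `φ` at time `t`. -/
def NLFPKEq (d : ℕ) (a : ℝ → SP d → Rd d → Fin d → Fin d → ℝ)
    (b : ℝ → SP d → Rd d → Fin d → ℝ) (μ : ℝ → SP d) (φ : Rd d → ℝ) (t : ℝ) : Prop :=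
  ∫ x, φ x ∂(μ t).1 - ∫ x, φ x ∂(μ 0).1 = ∫ s in (0:ℝ)..t, ∫ x, Lop a b s (μ s) φ x ∂(μ s).1

/-- Subprobability solution to (NLFPK): a vaguely continuous, globally integrable curve
in `SP` satisfying the weak equation for all test functions in `C²_c(ℝ^d)`. -/
def IsSubprobSolution (d : ℕ) (T : ℝ) (a : ℝ → SP d → Rd d → Fin d → Fin d → ℝ)
    (b : ℝ → SP d → Rd d → Fin d → ℝ) (μ : ℝ → SP d) : Prop :=
  ContinuousOn μ (Set.Icc 0 T) ∧ NLFPKIntegrable d T a b μ ∧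
  ∀ φ : Rd d → ℝ, IsC2c φ → ∀ t ∈ Set.Icc (0:ℝ) T, NLFPKEq d a b μ φ t

/-- Weak continuity (in duality with bounded continuous functions) of a curve in `SP`. -/
def WeaklyContinuousOn {d : ℕ} (μ : ℝ → SP d) (s : Set ℝ) : Prop :=
  ∀ f : Rd d → ℝ, Continuous f → (∃ M, ∀ x, |f x| ≤ M) →
    ContinuousOn (fun t => ∫ x, f x ∂(μ t).1) s

/-- Probability solution to (NLFPK): a weakly continuous solution consisting of
probability measures. -/
def IsProbSolution (d : ℕ) (T : ℝ) (a : ℝ → SP d → Rd d → Fin d → Fin d → ℝ)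
    (b : ℝ → SP d → Rd d → Fin d → ℝ) (μ : ℝ → SP d) : Prop :=
  IsSubprobSolution d T a b μ ∧ (∀ t ∈ Set.Icc (0:ℝ) T, (μ t).1 Set.univ = 1) ∧
  WeaklyContinuousOn μ (Set.Icc 0 T)

/-- `φ` and `ψ` are uniformly `ε`-close, together with their first and second order
partial derivatives (closeness in the `C²_b` norm). -/
def C2Close {n : ℕ} (φ ψ : (Fin n → ℝ) → ℝ) (ε : ℝ) : Prop :=
  (∀ x, |φ x - ψ x| ≤ ε) ∧ (∀ i x, |pd φ i x - pd ψ i x| ≤ ε) ∧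
  ∀ i j x, |pd2 φ i j x - pd2 ψ i j x| ≤ ε

/-- A countable family `g i ∈ C²_c(ℝ^d) \ {0}` which is dense in `C²_c(ℝ^d)` with respect
to the `C²_b` norm. -/
def GFamily (d : ℕ) (g : ℕ → Rd d → ℝ) : Prop :=
  (∀ i, IsC2c (g i)) ∧ (∀ i, g i ≠ 0) ∧
  ∀ φ : Rd d → ℝ, IsC2c φ → ∀ ε : ℝ, 0 < ε → ∃ i, C2Close (g i) φ ε

/-- The global chart `G : SP → ℝ^∞`, `G(μ) = (μ(g_i))_i`. -/
def Gmap {d : ℕ} (g : ℕ → Rd d → ℝ) (μ : SP d) : ℕ → ℝ := fun i => ∫ x, g i x ∂μ.1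

/-- `F(μ) = f(μ(g_1),…,μ(g_n))`, a typical element of `FC²_b(G)`. -/
def Fof {d : ℕ} (g : ℕ → Rd d → ℝ) {n : ℕ} (f : (Fin n → ℝ) → ℝ) (μ : SP d) : ℝ :=
  f fun k : Fin n => ∫ x, g k x ∂μ.1

/-- The action `𝐋_t F(μ) = ⟨∇^{SP} F(μ), b(t,μ) + a(t,μ)∇⟩_{L²(μ)}` of the linearized
operator on `F(μ) = f(μ(g_1),…,μ(g_n)) ∈ FC²_b(G)`. -/
def bL {d : ℕ} (a : ℝ → SP d → Rd d → Fin d → Fin d → ℝ)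
    (b : ℝ → SP d → Rd d → Fin d → ℝ) (g : ℕ → Rd d → ℝ) {n : ℕ}
    (f : (Fin n → ℝ) → ℝ) (t : ℝ) (μ : SP d) : ℝ :=
  ∑ k : Fin n, pd f k (fun l : Fin n => ∫ x, g l x ∂μ.1) * ∫ x, Lop a b t μ (g k) x ∂μ.1

/-- Weak continuity of a curve of Borel measures on `SP`. -/
def WeaklyContinuousMeasOn {d : ℕ} (Γ : ℝ → Measure (SP d)) (s : Set ℝ) : Prop :=
  ∀ F : SP d → ℝ, Continuous F → (∃ M, ∀ μ, |F μ| ≤ M) →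
    ContinuousOn (fun t => ∫ μ, F μ ∂(Γ t)) s

/-- Weakly continuous solution to the linearized continuity equation (SP-CE) on `P(SP)`. -/
def IsSPCESolution (d : ℕ) (T : ℝ) (a : ℝ → SP d → Rd d → Fin d → Fin d → ℝ)
    (b : ℝ → SP d → Rd d → Fin d → ℝ) (g : ℕ → Rd d → ℝ)
    (Γ : ℝ → Measure (SP d)) : Prop :=
  (∀ t ∈ Set.Icc (0:ℝ) T, IsProbabilityMeasure (Γ t)) ∧
  WeaklyContinuousMeasOn Γ (Set.Icc 0 T) ∧
  (∫⁻ t in Set.Ioc (0:ℝ) T, ∫⁻ μ : SP d,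
      (∫⁻ x, ENNReal.ofReal ((∑ i, |b t μ x i|) + ∑ i, ∑ j, |a t μ x i j|) ∂μ.1) ∂(Γ t) < ⊤) ∧
  ∀ (n : ℕ) (f : (Fin n → ℝ) → ℝ), IsC2b f → ∀ t ∈ Set.Icc (0:ℝ) T,
    ∫ μ, Fof g f μ ∂(Γ t) - ∫ μ, Fof g f μ ∂(Γ 0) =
      ∫ s in (0:ℝ)..t, ∫ μ, bL a b g f s μ ∂(Γ s)

section Lsc
variable {Z : Type*} [MetricSpace Z] [CompactSpace Z] [MeasurableSpace Z] [BorelSpace Z]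

lemma lowerSemicontinuous_of_seq {X : Type*} [TopologicalSpace X] [FirstCountableTopology X]
    {f : X → ENNReal}
    (h : ∀ (u : ℕ → X) (x : X), Tendsto u atTop (𝓝 x) → f x ≤ liminf (fun n => f (u n)) atTop) :
    LowerSemicontinuous f := by
  intro x y hy
  by_contra hcon
  have hfreq : ∃ᶠ x' in 𝓝 x, f x' ≤ y := by
    rw [Filter.Frequently]
    simpa only [not_le] using hcon
  obtain ⟨u, hu, huy⟩ := exists_seq_forall_of_frequently hfreq
  have h1 := h u x hu
  have h2 : liminf (fun n => f (u n)) atTop ≤ y :=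
    (liminf_le_liminf (Eventually.of_forall huy)).trans (by simp)
  exact absurd (hy.trans_le (h1.trans h2)) (lt_irrefl _)

lemma lowerSemicontinuous_lintegral_ofReal {f : Z → ℝ} (hf : LowerSemicontinuous f)
    (h0 : ∀ z, 0 ≤ f z) :
    LowerSemicontinuous fun γ : ProbabilityMeasure Z =>
      ∫⁻ z, ENNReal.ofReal (f z) ∂(γ : Measure Z) := by
  have key : ∀ γ : ProbabilityMeasure Z, ∫⁻ z, ENNReal.ofReal (f z) ∂(γ : Measure Z)
      = ∫⁻ t in Set.Ioi 0, (γ : Measure Z) {a : Z | t < f a} := fun γ =>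
    lintegral_eq_lintegral_meas_lt _ (Eventually.of_forall h0) hf.measurable.aemeasurable
  refine lowerSemicontinuous_of_seq fun u γ hu => ?_
  simp_rw [key]
  have hm : ∀ γ : ProbabilityMeasure Z, Measurable fun t : ℝ =>
      (γ : Measure Z) {a : Z | t < f a} := by
    intro γ
    refine Antitone.measurable fun s t hst => measure_mono fun z hz => lt_of_le_of_lt hst hz
  refine le_trans ?_ (lintegral_liminf_le fun n => hm (u n))
  refine lintegral_mono fun t => ?_
  exact ProbabilityMeasure.le_liminf_measure_open_of_tendsto hu (hf.isOpen_preimage t)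

lemma lowerSemicontinuous_lintegral {W : Z → ENNReal} (hW : LowerSemicontinuous W) :
    LowerSemicontinuous fun γ : ProbabilityMeasure Z => ∫⁻ z, W z ∂(γ : Measure Z) := by
  have hsup : ∀ γ : ProbabilityMeasure Z, ∫⁻ z, W z ∂(γ : Measure Z)
      = ⨆ n : ℕ, ∫⁻ z, ENNReal.ofReal (min (W z) n).toReal ∂(γ : Measure Z) := by
    intro γ
    rw [← lintegral_iSup]
    · refine lintegral_congr fun z => ?_
      have : ∀ n : ℕ, ENNReal.ofReal (min (W z) n).toReal = min (W z) n := fun n =>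
        ENNReal.ofReal_toReal (ne_top_of_le_ne_top (ENNReal.natCast_ne_top n) (min_le_right _ _))
      simp_rw [this]
      rw [show (⨆ n : ℕ, min (W z) (n : ENNReal)) = W z ⊓ ⨆ n : ℕ, (n : ENNReal) from
        (inf_iSup_eq (W z) fun n : ℕ => (n : ENNReal)).symm]
      simp [ENNReal.iSup_natCast]
    · intro n
      have := hW.measurable
      fun_prop
    · intro m n hmn z
      refine ENNReal.ofReal_le_ofReal (ENNReal.toReal_mono
        (ne_top_of_le_ne_top (ENNReal.natCast_ne_top n) (min_le_right _ _)) ?_)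
      exact min_le_min le_rfl (by exact_mod_cast hmn)
  simp_rw [hsup]
  refine lowerSemicontinuous_iSup fun n => ?_
  refine lowerSemicontinuous_lintegral_ofReal ?_ fun z => ENNReal.toReal_nonneg
  intro z y hy
  by_cases hy0 : y < 0
  · exact Eventually.of_forall fun _ => hy0.trans_le ENNReal.toReal_nonneg
  push Not at hy0
  have hfin : ∀ z, min (W z) n ≠ ⊤ := fun z => 
    ne_top_of_le_ne_top (ENNReal.natCast_ne_top n) (min_le_right _ _)
  replace hy : ENNReal.ofReal y < min (W z) n := (ENNReal.ofReal_lt_iff_lt_toReal hy0 (hfin z)).2 hy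
  filter_upwards [hW z _ (hy.trans_le (min_le_left _ _))] with z' hz'
  refine (ENNReal.ofReal_lt_iff_lt_toReal hy0 (hfin z')).1 ?_
  exact lt_min hz' (hy.trans_le (min_le_right _ _))

end Lsc

section Weight
variable {Z : Type*} [MetricSpace Z] [CompactSpace Z] [MeasurableSpace Z] [BorelSpace Z]

/-- A lower semicontinuous integrable weight controlling continuous approximations. -/
lemma exists_weight (γ : Measure Z) [IsFiniteMeasure γ] (B : ℕ → Z → ℝ)
    (hB : ∀ k, Measurable (B k)) (hBi : ∀ k, Integrable (B k) γ) (N : Z → ENNReal)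
    (hN : Measurable N) (hNi : ∫⁻ z, N z ∂γ < ⊤) :
    ∃ W : Z → ENNReal, LowerSemicontinuous W ∧ ∫⁻ z, W z ∂γ < ⊤ ∧ (∀ z, N z ≤ W z) ∧
      (∀ z, 1 ≤ W z) ∧
      ∀ k, ∀ δ : NNReal, 0 < δ → ∃ w : Z → ℝ, Continuous w ∧
        ∀ z, ‖B k z - w z‖ₑ ≤ δ * W z := by
  obtain ⟨ε, hε, hεs⟩ := ENNReal.exists_pos_sum_of_countable (ι := ℕ) one_ne_zero
  have h1 : ∀ i : ℕ, ∃ w : Z → ℝ, ∃ h : Z → ENNReal, Continuous w ∧ LowerSemicontinuous h ∧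
      (∀ z, ‖B i.unpair.1 z - w z‖ₑ ≤ h z) ∧
      ∫⁻ z, h z ∂γ ≤ 2 * (ε i / (i.unpair.2 + 1 : ENNReal)) := by
    intro i
    have hpos : (ε i : ENNReal) / (i.unpair.2 + 1 : ENNReal) ≠ 0 := by
      refine (ENNReal.div_pos (by simpa using (hε i).ne') ?_).ne'
      finiteness
    obtain ⟨w, hw, -⟩ := (hBi i.unpair.1).exists_boundedContinuous_lintegral_sub_le hpos
    obtain ⟨h, hh, hlsc, hhi⟩ := exists_le_lowerSemicontinuous_lintegral_ge γ
      (fun z => ‖B i.unpair.1 z - w z‖ₑ)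
      (((hB _).sub w.continuous.measurable).enorm) hpos
    refine ⟨w, h, w.continuous, hlsc, hh, hhi.trans ?_⟩
    rw [two_mul]; gcongr
  choose w h hw hh hwh hhi using h1
  obtain ⟨N', hN', hlsc, hN'i⟩ := exists_le_lowerSemicontinuous_lintegral_ge γ N hN one_ne_zero
  have hmeas : ∀ i, Measurable fun z => ((i.unpair.2 + 1 : ℕ) : ENNReal) * h i z := fun i =>
    (hh i).measurable.const_mul _
  refine ⟨fun z => 1 + N' z + ∑' i : ℕ, ((i.unpair.2 + 1 : ℕ) : ENNReal) * h i z, ?_, ?_, ?_, ?_,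
      ?_⟩
  · refine (lowerSemicontinuous_const.add hlsc).add (lowerSemicontinuous_tsum fun i => ?_)
    simp_rw [← nsmul_eq_mul]
    generalize i.unpair.2 + 1 = m
    induction m with
    | zero => simpa using lowerSemicontinuous_const
    | succ m ih => simp_rw [succ_nsmul]; exact ih.add (hh i)
  · rw [lintegral_add_right _ (Measurable.tsum hmeas),
      lintegral_add_right _ hlsc.measurable, lintegral_tsum fun i => (hmeas i).aemeasurable]
    have h2 : ∑' i : ℕ, ∫⁻ z, ((i.unpair.2 + 1 : ℕ) : ENNReal) * h i z ∂γ ≤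
        ∑' i, 2 * (ε i : ENNReal) := by
      refine ENNReal.tsum_le_tsum fun i => ?_
      rw [lintegral_const_mul _ (hh i).measurable]
      calc _ ≤ ((i.unpair.2 + 1 : ℕ) : ENNReal) * (2 * (ε i / (i.unpair.2 + 1 : ENNReal))) := by
            gcongr; exact hhi i
        _ = 2 * (((i.unpair.2 + 1 : ℕ) : ENNReal) * (ε i / ((i.unpair.2 + 1 : ℕ) : ENNReal))) := by
            push_cast; ring
        _ = _ := by rw [ENNReal.mul_div_cancel (by simp) (by finiteness)]
    rw [ENNReal.tsum_mul_left] at h2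
    have h3 : ∑' i : ℕ, ∫⁻ z, ((i.unpair.2 + 1 : ℕ) : ENNReal) * h i z ∂γ < ⊤ :=
      h2.trans_lt (ENNReal.mul_lt_top (by simp) (hεs.trans (by simp)))
    refine ENNReal.add_lt_top.2 ⟨ENNReal.add_lt_top.2 ⟨by simp, ?_⟩, h3⟩
    exact hN'i.trans_lt (ENNReal.add_lt_top.2 ⟨hNi, by simp⟩)
  · intro z
    exact (hN' z).trans (le_add_left le_rfl |>.trans le_self_add)
  · intro z
    exact le_self_add.trans le_self_add
  · intro k δ hδ
    obtain ⟨m, hm⟩ := exists_nat_one_div_lt hδ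
    refine ⟨w (Nat.pair k m), hw _, fun z => ?_⟩
    have h4 := hwh (Nat.pair k m) z
    simp only [Nat.unpair_pair] at h4
    refine h4.trans ?_
    have h5 : ((m + 1 : ℕ) : ENNReal) * h (Nat.pair k m) z ≤
        1 + N' z + ∑' i : ℕ, ((i.unpair.2 + 1 : ℕ) : ENNReal) * h i z := by
      refine le_trans ?_ le_add_self
      have := ENNReal.le_tsum (f := fun i : ℕ => ((i.unpair.2 + 1 : ℕ) : ENNReal) * h i z)
          (Nat.pair k m)
      simpa only [Nat.unpair_pair] using this
    calc h (Nat.pair k m) z = ((m + 1 : ℕ) : ENNReal)⁻¹ * (((m + 1 : ℕ) : ENNReal) * h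
        (Nat.pair k m) z) := by
          rw [← mul_assoc, ENNReal.inv_mul_cancel (by simp) (by finiteness), one_mul]
      _ ≤ δ * _ := by
          gcongr
          have : ((1 / ((m:NNReal) + 1) : NNReal) : ENNReal) ≤ δ := by exact_mod_cast hm.le
          refine le_trans (le_of_eq ?_) this
          rw [ENNReal.coe_div (by positivity)]
          simp
end Weight

section Duality
variable {Z : Type*} [MeasurableSpace Z] 

/-- A continuous linear functional on `L¹` of a finite measure is represented by a bounded
function. -/
lemma exists_bounded_repr (γ : Measure Z) [IsFiniteMeasure γ] (l : Lp ℝ 1 γ →L[ℝ] ℝ) :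
    ∃ u : Z → ℝ, Measurable u ∧ (∀ z, |u z| ≤ ‖l‖) ∧ ∀ v : Z → ℝ, ∀ hv : MemLp v 1 γ,
      l (hv.toLp v) = ∫ z, u z * v z ∂γ := by
  have h12 : ∀ f : Lp ℝ 2 γ, MemLp f 1 γ := fun f => (Lp.memLp f).mono_exponent (by norm_num)
  let A : Lp ℝ 2 γ →ₗ[ℝ] ℝ :=
    { toFun := fun f => l ((h12 f).toLp f)
      map_add' := fun f g => by
        rw [← map_add, ← MemLp.toLp_add]
        exact congrArg l (MemLp.toLp_congr _ _ (Lp.coeFn_add f g))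
      map_smul' := fun c f => by
        rw [RingHom.id_apply, ← map_smul, ← MemLp.toLp_const_smul]
        exact congrArg l (MemLp.toLp_congr _ _ (Lp.coeFn_smul c f)) }
  let K : ENNReal := γ Set.univ ^ (1 / (1 : ENNReal).toReal - 1 / (2 : ENNReal).toReal)
  have hK : K ≠ ⊤ := ENNReal.rpow_ne_top_of_nonneg (by norm_num) (measure_ne_top _ _)
  let A' : Lp ℝ 2 γ →L[ℝ] ℝ := A.mkContinuous (‖l‖ * K.toReal) fun f => by
    change ‖l ((h12 f).toLp f)‖ ≤ _
    refine (l.le_opNorm _).trans ?_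
    rw [mul_assoc]
    refine mul_le_mul_of_nonneg_left ?_ (norm_nonneg _)
    rw [Lp.norm_toLp, Lp.norm_def, ← ENNReal.toReal_mul, mul_comm]
    refine ENNReal.toReal_mono (ENNReal.mul_ne_top (Lp.eLpNorm_ne_top f) hK) ?_
    exact eLpNorm_le_eLpNorm_mul_rpow_measure_univ (by norm_num) (Lp.aestronglyMeasurable f)
  let u' : Lp ℝ 2 γ := (InnerProductSpace.toDual ℝ (Lp ℝ 2 γ)).symm A'
  have hu' : ∀ f : Lp ℝ 2 γ, l ((h12 f).toLp f) = ∫ z, u' z * f z ∂γ := by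
    intro f
    have : A' f = inner ℝ u' f := by
      rw [← InnerProductSpace.toDual_apply_apply (𝕜 := ℝ), LinearIsometryEquiv.apply_symm_apply]
    rw [L2.inner_def] at this
    change l _ = _ at this
    rw [this]
    refine integral_congr_ae (Eventually.of_forall fun z => ?_)
    simp [mul_comm]
  have hset : ∀ (c : ℝ) (s : Set Z), MeasurableSet s → ∀ h : MemLp (s.indicator fun _ => c) 1 γ,
      l (h.toLp _) = c * ∫ z in s, u' z ∂γ := by
    intro c s hs h
    have h2 : MemLp (s.indicator fun _ : Z => c) 2 γ := (memLp_const c).indicator hs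
    have := hu' (h2.toLp _)
    rw [MemLp.toLp_congr (h12 _) h h2.coeFn_toLp] at this
    rw [this, ← integral_indicator hs, ← integral_const_mul]
    refine integral_congr_ae ?_
    filter_upwards [h2.coeFn_toLp] with z hz
    rw [hz]
    by_cases hzs : z ∈ s <;> simp [hzs, mul_comm]
  have hu'i : Integrable u' γ := memLp_one_iff_integrable.1 (h12 u')
  have hbd : ∀ s, MeasurableSet s → |∫ z in s, u' z ∂γ| ≤ ∫ z in s, ‖l‖ ∂γ := by
    intro s hs
    have h1 : MemLp (s.indicator fun _ : Z => (1 : ℝ)) 1 γ := (memLp_const 1).indicator hs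
    have h2 := l.le_opNorm (h1.toLp _)
    rw [hset 1 s hs h1, one_mul, Real.norm_eq_abs, L1.norm_eq_integral_norm] at h2
    refine h2.trans (le_of_eq ?_)
    rw [integral_const, smul_eq_mul, mul_comm]
    congr 1
    rw [integral_congr_ae (g := s.indicator fun _ => (1 : ℝ)), integral_indicator hs]
    · simp
    · filter_upwards [h1.coeFn_toLp] with z hz
      rw [hz]
      by_cases hzs : z ∈ s <;> simp [hzs]
  have hle : (u' : Z → ℝ) ≤ᵐ[γ] fun _ => ‖l‖ := ae_le_of_forall_setIntegral_le hu'i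
    (integrable_const _) fun s hs _ => (le_abs_self _).trans (hbd s hs)
  have hge : (fun z => - u' z) ≤ᵐ[γ] fun _ => ‖l‖ := ae_le_of_forall_setIntegral_le hu'i.neg
    (integrable_const _) fun s hs _ => by
      rw [integral_neg]; exact (neg_le_abs _).trans (hbd s hs)
  let u : Z → ℝ := fun z => max (-‖l‖) (min (u' z) ‖l‖)
  have huu' : u =ᵐ[γ] u' := by
    filter_upwards [hle, hge] with z h1 h2
    simp only [u]
    rw [min_eq_left h1, max_eq_right (by linarith)]
  have hum : Measurable u :=
    measurable_const.max ((Lp.stronglyMeasurable u').measurable.min measurable_const)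
  have hub : ∀ z, |u z| ≤ ‖l‖ := fun z =>
    abs_le.2 ⟨le_max_left _ _, max_le (by linarith [norm_nonneg l]) (min_le_right _ _)⟩
  have humul : ∀ v : Z → ℝ, Integrable v γ → Integrable (fun z => u z * v z) γ := fun v hv =>
    hv.bdd_mul hum.aestronglyMeasurable (Eventually.of_forall hub)
  refine ⟨u, hum, hub, fun v hv => ?_⟩
  have key : ∀ f : Lp ℝ 1 γ, l f = ∫ z, u z * f z ∂γ := by
    refine Lp.induction ENNReal.one_ne_top _ ?_ ?_ ?_
    · intro c s hs hsμ
      have h1 : MemLp (s.indicator fun _ : Z => c) 1 γ := (memLp_const c).indicator hs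
      have e1 : ((Lp.simpleFunc.indicatorConst 1 hs hsμ.ne c : Lp.simpleFunc ℝ 1 γ) : Lp ℝ 1 γ)
          = h1.toLp _ := by
        rw [Lp.simpleFunc.coe_indicatorConst]; rfl
      rw [e1, hset c s hs h1, ← integral_indicator hs, ← integral_const_mul]
      refine integral_congr_ae ?_
      filter_upwards [h1.coeFn_toLp, huu'] with z hz hz2
      rw [hz, hz2]
      by_cases hzs : z ∈ s <;> simp [hzs, mul_comm]
    · intro f g hf hg _ h1 h2
      rw [map_add, h1, h2, ← integral_add (humul _ (L1.integrable_coeFn _))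
        (humul _ (L1.integrable_coeFn _))]
      refine integral_congr_ae ?_
      filter_upwards [Lp.coeFn_add (hf.toLp f) (hg.toLp g)] with z hz
      rw [hz, Pi.add_apply, mul_add]
    · have : Continuous fun f : Lp ℝ 1 γ => ∫ z, u z * f z ∂γ := by
        refine LipschitzWith.continuous (K := ‖l‖₊) (LipschitzWith.of_dist_le_mul fun f g => ?_)
        rw [Real.dist_eq, ← integral_sub (humul _ (L1.integrable_coeFn _))
          (humul _ (L1.integrable_coeFn _)), dist_eq_norm, L1.norm_eq_integral_norm,
          ← integral_const_mul]
        refine (abs_integral_le_integral_abs).trans (integral_mono_of_nonneg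
          (Eventually.of_forall fun _ => abs_nonneg _)
          ((L1.integrable_coeFn _).norm.const_mul _) ?_)
        filter_upwards [Lp.coeFn_sub f g] with z hz
        rw [hz, Pi.sub_apply, ← mul_sub, abs_mul, Real.norm_eq_abs]
        exact mul_le_mul_of_nonneg_right (hub z) (abs_nonneg _)
      exact isClosed_eq l.continuous this
  rw [key]
  refine integral_congr_ae ?_
  filter_upwards [hv.coeFn_toLp] with z hz
  rw [hz]

/-- A space of integrable functions without nonzero bounded annihilator is dense in `L¹`. -/
lemma dense_of_annihilator (γ : Measure Z) [IsFiniteMeasure γ] (S : Set (Z → ℝ))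
    (h0 : (0 : Z → ℝ) ∈ S) (hadd : ∀ v ∈ S, ∀ w ∈ S, v + w ∈ S)
    (hsmul : ∀ (c : ℝ), ∀ v ∈ S, c • v ∈ S) (hint : ∀ v ∈ S, Integrable v γ)
    (hann : ∀ u : Z → ℝ, Measurable u → (∀ z, |u z| ≤ 1) → (∀ v ∈ S, ∫ z, u z * v z ∂γ = 0) →
      u =ᵐ[γ] 0) (h : Z → ℝ) (hh : Integrable h γ) (ε : ℝ) (hε : 0 < ε) :
    ∃ v ∈ S, ∫ z, |v z - h z| ∂γ < ε := by
  classical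
  let V : Submodule ℝ (Lp ℝ 1 γ) :=
    { carrier := {x | ∃ v ∈ S, x =ᵐ[γ] v}
      add_mem' := by
        rintro x y ⟨v, hv, hxv⟩ ⟨w, hw, hyw⟩
        exact ⟨v + w, hadd v hv w hw, (Lp.coeFn_add x y).trans (hxv.add hyw)⟩
      zero_mem' := ⟨0, h0, Lp.coeFn_zero ℝ 1 γ⟩
      smul_mem' := by
        rintro c x ⟨v, hv, hxv⟩
        exact ⟨c • v, hsmul c v hv, (Lp.coeFn_smul c x).trans (hxv.const_smul c)⟩ }
  have hh1 : MemLp h 1 γ := memLp_one_iff_integrable.2 hh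
  have hmem : hh1.toLp h ∈ closure (V : Set (Lp ℝ 1 γ)) := by
    by_contra hcon
    obtain ⟨l, c, hlc, hV⟩ := geometric_hahn_banach_point_closed
      (V.convex.closure) isClosed_closure hcon
    have hV0 : ∀ x ∈ V, l x = 0 := by
      intro x hx
      by_contra hne
      have := hV (((c - 1) / l x) • x) (subset_closure (V.smul_mem _ hx))
      rw [map_smul, smul_eq_mul, div_mul_cancel₀ _ hne] at this
      linarith
    have hc : c < 0 := by
      have := hV 0 (subset_closure V.zero_mem); simpa using this
    obtain ⟨u, hum, hub, hu⟩ := exists_bounded_repr γ l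
    have hu0 : u =ᵐ[γ] 0 := by
      have hM : 0 < ‖l‖ + 1 := by positivity
      have := hann (fun z => (‖l‖ + 1)⁻¹ * u z) (hum.const_mul _) (fun z => by
        rw [abs_mul, abs_of_pos (inv_pos.2 hM), inv_mul_le_iff₀ hM]; linarith [hub z])
            (fun v hv => by
        have hv1 : MemLp v 1 γ := memLp_one_iff_integrable.2 (hint v hv)
        simp_rw [mul_assoc]
        rw [integral_const_mul, ← hu v hv1, hV0 _ ⟨v, hv, hv1.coeFn_toLp⟩, mul_zero])
      filter_upwards [this] with z hz
      simpa [hM.ne'] using hz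
    have : l (hh1.toLp h) = 0 := by
      rw [hu h hh1]
      refine integral_eq_zero_of_ae ?_
      filter_upwards [hu0] with z hz
      simp [hz]
    linarith
  obtain ⟨x, ⟨v, hv, hxv⟩, hd⟩ := Metric.mem_closure_iff.1 hmem ε hε
  refine ⟨v, hv, lt_of_eq_of_lt ?_ hd⟩
  rw [dist_comm, dist_eq_norm, L1.norm_eq_integral_norm]
  refine integral_congr_ae ?_
  filter_upwards [hxv, hh1.coeFn_toLp, Lp.coeFn_sub x (hh1.toLp h)] with z h1 h2 h3
  rw [h3, Pi.sub_apply, h1, h2, Real.norm_eq_abs]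
end Duality

/-- `φ` is a `C³` cylindrical function of the coordinates `E`, and `v` is its derivative along
the field `B`. -/
def IsTest {Z : Type*} (E B : ℕ → Z → ℝ) (φ v : Z → ℝ) : Prop :=
  ∃ n₀ : ℕ, ∀ n ≥ n₀, ∃ f : (Fin n → ℝ) → ℝ, ContDiff ℝ 3 f ∧
    (∀ z, φ z = f fun k => E k z) ∧ ∀ z, v z = fderiv ℝ f (fun k => E k z) (fun k => B k z)

/-- Weak stationarity on `[0, 1]` of a measure with respect to the field `B`, started at `z0`. -/
def IsSol {Z : Type*} [MeasurableSpace Z] (E B : ℕ → Z → ℝ) (z0 : Z) (γ : Measure Z) : Prop :=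
  ∀ φ v, IsTest E B φ v → (∀ z, E 0 z = 1 → φ z = 0) → ∫ z, v z ∂γ = - φ z0

namespace IsTest
variable {Z : Type*} {E B : ℕ → Z → ℝ} {φ φ' v v' : Z → ℝ}

lemma const (c : ℝ) : IsTest E B (fun _ => c) (fun _ => 0) :=
  ⟨0, fun _ _ => ⟨fun _ => c, contDiff_const, fun _ => rfl, fun _ => by simp⟩⟩

lemma coord (k : ℕ) : IsTest E B (E k) (B k) :=
  ⟨k + 1, fun _ hn => ⟨fun x => x ⟨k, hn⟩, contDiff_apply _ _ _, fun _ => rfl, fun z => by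
    rw [show (fun x : Fin _ → ℝ => x ⟨k, hn⟩) = ContinuousLinearMap.proj (R := ℝ) ⟨k, hn⟩ from rfl,
      ContinuousLinearMap.fderiv]
    rfl⟩⟩

lemma add (h : IsTest E B φ v) (h' : IsTest E B φ' v') :
    IsTest E B (fun z => φ z + φ' z) (fun z => v z + v' z) := by
  obtain ⟨n, h⟩ := h
  obtain ⟨m, h'⟩ := h'
  refine ⟨max n m, fun k hk => ?_⟩
  obtain ⟨f, hf, h1, h2⟩ := h k ((le_max_left _ _).trans hk)
  obtain ⟨f', hf', h1', h2'⟩ := h' k ((le_max_right _ _).trans hk)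
  refine ⟨fun x => f x + f' x, hf.add hf', fun z => by simp only [h1, h1'], fun z => ?_⟩
  rw [fderiv_fun_add (hf.differentiable (by norm_num) _) (hf'.differentiable (by norm_num) _)]
  simp only [h2, h2']
  rfl

lemma mul (h : IsTest E B φ v) (h' : IsTest E B φ' v') :
    IsTest E B (fun z => φ z * φ' z) (fun z => φ z * v' z + φ' z * v z) := by
  obtain ⟨n, h⟩ := h
  obtain ⟨m, h'⟩ := h'
  refine ⟨max n m, fun k hk => ?_⟩
  obtain ⟨f, hf, h1, h2⟩ := h k ((le_max_left _ _).trans hk)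
  obtain ⟨f', hf', h1', h2'⟩ := h' k ((le_max_right _ _).trans hk)
  refine ⟨fun x => f x * f' x, hf.mul hf', fun z => by simp only [h1, h1'], fun z => ?_⟩
  rw [fderiv_fun_mul (hf.differentiable (by norm_num) _) (hf'.differentiable (by norm_num) _)]
  simp only [h2, h2', h1, h1']
  rfl

lemma comp (h : IsTest E B φ v) {β : ℝ → ℝ} (hβ : ContDiff ℝ 3 β) :
    IsTest E B (fun z => β (φ z)) (fun z => deriv β (φ z) * v z) := by
  obtain ⟨n, h⟩ := h
  refine ⟨n, fun k hk => ?_⟩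
  obtain ⟨f, hf, h1, h2⟩ := h k hk
  refine ⟨fun x => β (f x), hβ.comp hf, fun z => by simp only [h1], fun z => ?_⟩
  rw [show (fun x => β (f x)) = β ∘ f from rfl,
    fderiv_comp _ (hβ.differentiable (by norm_num) _) (hf.differentiable (by norm_num) _)]
  simp [h1, h2, mul_comm]

lemma congr (h : IsTest E B φ v) (h1 : ∀ z, φ' z = φ z) (h2 : ∀ z, v' z = v z) :
    IsTest E B φ' v' := by
  rwa [funext h1, funext h2]

lemma const_mul (h : IsTest E B φ v) (c : ℝ) :
    IsTest E B (fun z => c * φ z) (fun z => c * v z) :=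
  ((const c).mul h).congr (fun _ => rfl) fun z => by ring

lemma neg (h : IsTest E B φ v) : IsTest E B (fun z => - φ z) (fun z => - v z) :=
  (h.const_mul (-1)).congr (fun z => by ring) fun z => by ring

lemma sub (h : IsTest E B φ v) (h' : IsTest E B φ' v') :
    IsTest E B (fun z => φ z - φ' z) (fun z => v z - v' z) :=
  (h.add h'.neg).congr (fun z => by ring) fun z => by ring

lemma continuous [TopologicalSpace Z] (hE : ∀ k, Continuous (E k)) (h : IsTest E B φ v) :
    Continuous φ := by
  obtain ⟨n, h⟩ := h
  obtain ⟨f, hf, h1, -⟩ := h n le_rfl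
  rw [funext h1]
  exact hf.continuous.comp (continuous_pi fun k => hE k)

lemma eq_sum [TopologicalSpace Z] (hE : ∀ k, Continuous (E k)) (h : IsTest E B φ v) :
    ∃ n : ℕ, ∃ c : ℕ → Z → ℝ, (∀ k, Continuous (c k)) ∧
      ∀ z, v z = ∑ k ∈ Finset.range n, c k z * B k z := by
  classical
  obtain ⟨n, h⟩ := h
  obtain ⟨f, hf, -, h2⟩ := h n le_rfl
  refine ⟨n, fun k z => if hk : k < n then
    fderiv ℝ f (fun k => E k z) (Pi.single (⟨k, hk⟩ : Fin n) 1) else 0, fun k => ?_, fun z => ?_⟩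
  · by_cases hk : k < n
    · simp only [hk, dif_pos]
      exact ((hf.continuous_fderiv (by norm_num)).comp (continuous_pi fun k => hE k)).clm_apply
        continuous_const
    · simp only [hk, dif_neg, not_false_eq_true]
      exact continuous_const
  · rw [h2, Finset.sum_range]
    simp only [Fin.is_lt, dif_pos, Fin.eta]
    conv_lhs => rw [pi_eq_sum_univ' (fun k : Fin n => B k z)]
    rw [map_sum]
    refine Finset.sum_congr rfl fun i _ => ?_
    rw [map_smul, smul_eq_mul, mul_comm]

lemma measurable [TopologicalSpace Z] [MeasurableSpace Z] [BorelSpace Z]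
    (hE : ∀ k, Continuous (E k)) (hB : ∀ k, Measurable (B k)) (h : IsTest E B φ v) :
    Measurable v := by
  obtain ⟨n, c, hc, hv⟩ := h.eq_sum hE
  rw [funext hv]
  exact Finset.measurable_fun_sum _ fun k _ => (hc k).measurable.mul (hB k)

end IsTest

section Approx
variable {Z : Type*} [TopologicalSpace Z] [CompactSpace Z] [MeasurableSpace Z] [BorelSpace Z]

/-- `v` is approximated by continuous functions, uniformly relative to the weight `W`. -/
def WApprox (W : Z → ENNReal) (v : Z → ℝ) : Prop :=
  ∀ δ : NNReal, 0 < δ → ∃ w : Z → ℝ, Continuous w ∧ ∀ z, ‖v z - w z‖ₑ ≤ δ * W z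

omit [MeasurableSpace Z] [BorelSpace Z] in
lemma WApprox.mul_add {W : Z → ENNReal} {v v' c : Z → ℝ} (hv : WApprox W v) (hv' : WApprox W v')
    (hc : Continuous c) : WApprox W fun z => v' z + c z * v z := by
  intro δ hδ
  obtain ⟨M, hM⟩ : ∃ M : NNReal, ∀ z, ‖c z‖₊ ≤ M := by
    obtain ⟨M, hM⟩ := isCompact_univ.exists_bound_of_continuousOn hc.continuousOn
    exact ⟨⟨max M 0, le_max_right _ _⟩, fun z => (hM z trivial).trans (le_max_left _ _)⟩
  have h2 : 0 < δ / (M + 1) / 2 := by positivity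
  obtain ⟨w, hw, hwb⟩ := hv _ h2
  obtain ⟨w', hw', hwb'⟩ := hv' (δ / 2) (by positivity)
  refine ⟨fun z => w' z + c z * w z, hw'.add (hc.mul hw), fun z => ?_⟩
  calc ‖v' z + c z * v z - (w' z + c z * w z)‖ₑ
      = ‖(v' z - w' z) + c z * (v z - w z)‖ₑ := by congr 1; ring
    _ ≤ ‖v' z - w' z‖ₑ + ‖c z‖ₑ * ‖v z - w z‖ₑ := by
        rw [← enorm_mul]; exact enorm_add_le _ _
    _ ≤ (δ / 2 : NNReal) * W z + (M : ENNReal) * ((δ / (M + 1) / 2 : NNReal) * W z) := by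
        gcongr
        · exact hwb' z
        · exact ENNReal.coe_le_coe.2 (hM z)
        · exact hwb z
    _ = ((δ / 2 + M * (δ / (M + 1) / 2) : NNReal) : ENNReal) * W z := by push_cast; ring
    _ ≤ δ * W z := by
        gcongr
        rw [← NNReal.coe_le_coe]
        push_cast
        have : (M : ℝ) / (M + 1) ≤ 1 := by rw [div_le_one (by positivity)]; linarith
        have hd : (0 : ℝ) ≤ δ := δ.2
        calc (δ : ℝ) / 2 + M * (δ / (M + 1) / 2) = δ / 2 + δ / 2 * (M / (M + 1)) := by ring
          _ ≤ δ / 2 + δ / 2 * 1 := by gcongr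
          _ = δ := by ring

omit [MeasurableSpace Z] [BorelSpace Z] in
lemma IsTest.wApprox {W : Z → ENNReal} {E B : ℕ → Z → ℝ} (hE : ∀ k, Continuous (E k))
    (hW : ∀ k, WApprox W (B k)) {φ v : Z → ℝ} (h : IsTest E B φ v) : WApprox W v := by
  obtain ⟨n, c, hc, hv⟩ := h.eq_sum hE
  rw [funext hv]
  clear hv
  induction n with
  | zero => exact fun δ _ => ⟨0, continuous_const, fun z => by simp⟩
  | succ n ih =>
    simp_rw [Finset.sum_range_succ]
    exact (hW n).mul_add ih (hc n)

lemma WApprox.integrable {W : Z → ENNReal} {v : Z → ℝ} (h : WApprox W v) (hv : Measurable v)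
    {γ : Measure Z} [IsFiniteMeasure γ] (hW : ∫⁻ z, W z ∂γ < ⊤) : Integrable v γ := by
  obtain ⟨w, hw, hb⟩ := h 1 one_pos
  have h1 : Integrable w γ := by
    obtain ⟨M, hM⟩ := isCompact_univ.exists_bound_of_continuousOn hw.continuousOn
    exact Integrable.of_bound hw.measurable.aestronglyMeasurable M
      (Eventually.of_forall fun z => hM z trivial)
  have h2 : Integrable (fun z => v z - w z) γ := by
    refine ⟨(hv.sub hw.measurable).aestronglyMeasurable, ?_⟩
    refine lt_of_le_of_lt (lintegral_mono fun z => ?_) hW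
    simpa using hb z
  exact (h2.add h1).congr (Eventually.of_forall fun z => by simp)

lemma abs_integral_sub_le_of_enorm_le {Z : Type*} [MeasurableSpace Z] {W : Z → ENNReal}
    {v w : Z → ℝ} {δ C : NNReal} {γ : Measure Z}
    (hb : ∀ z, ‖v z - w z‖ₑ ≤ δ * W z) (hv : Integrable v γ) (hw : Integrable w γ)
    (hW : ∫⁻ z, W z ∂γ ≤ C) : |∫ z, v z ∂γ - ∫ z, w z ∂γ| ≤ δ * C := by
  rw [← integral_sub hv hw]
  have h1 : ‖∫ z, v z - w z ∂γ‖ₑ ≤ (δ * C : NNReal) := by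
    refine (enorm_integral_le_lintegral_enorm _).trans ((lintegral_mono hb).trans ?_)
    rw [lintegral_const_mul' _ _ ENNReal.coe_ne_top, ENNReal.coe_mul]
    gcongr
  have h2 : ‖∫ z, v z - w z ∂γ‖₊ ≤ δ * C := by exact_mod_cast h1
  exact_mod_cast h2

lemma integrable_of_continuous {f : Z → ℝ} (hf : Continuous f) (γ : Measure Z)
    [IsFiniteMeasure γ] : Integrable f γ := by
  obtain ⟨M, hM⟩ := isCompact_univ.exists_bound_of_continuousOn hf.continuousOn
  exact Integrable.of_bound hf.measurable.aestronglyMeasurable M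
    (Eventually.of_forall fun z => hM z trivial)
end Approx

section Extremal
variable {Z : Type*} [MetricSpace Z] [CompactSpace Z] [MeasurableSpace Z] [BorelSpace Z]

lemma continuous_integral_probabilityMeasure {f : Z → ℝ} (hf : Continuous f) :
    Continuous fun γ : ProbabilityMeasure Z => ∫ z, f z ∂(γ : Measure Z) := by
  rw [continuous_iff_continuousAt]
  intro γ
  exact (ProbabilityMeasure.tendsto_iff_forall_integral_tendsto.1 tendsto_id)
    (BoundedContinuousFunction.mkOfCompact ⟨f, hf⟩)

lemma isClosed_setOf_isSol {E B : ℕ → Z → ℝ} (hE : ∀ k, Continuous (E k))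
    (hB : ∀ k, Measurable (B k)) (z0 : Z) {W : Z → ENNReal} (hW : LowerSemicontinuous W)
    (hWB : ∀ k, WApprox W (B k)) (C : NNReal) :
    IsClosed {γ : ProbabilityMeasure Z | IsSol E B z0 (γ : Measure Z) ∧
      ∫⁻ z, W z ∂(γ : Measure Z) ≤ C} := by
  refine IsSeqClosed.isClosed fun u γ hu hγ => ?_
  have hWC : ∫⁻ z, W z ∂(γ : Measure Z) ≤ C := by
    have := (lowerSemicontinuous_lintegral hW).isClosed_preimage C
    exact this.mem_of_tendsto hγ (Eventually.of_forall fun n => (hu n).2)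
  refine ⟨fun φ v hv h1 => ?_, hWC⟩
  have hva := hv.wApprox hE hWB
  have hvm := hv.measurable hE hB
  have hint : ∀ γ : ProbabilityMeasure Z, ∫⁻ z, W z ∂(γ : Measure Z) ≤ C →
      Integrable v (γ : Measure Z) :=
    fun γ h => hva.integrable hvm (h.trans_lt ENNReal.coe_lt_top)
  rw [← sub_eq_zero, ← abs_nonpos_iff]
  refine le_of_forall_pos_le_add fun ε hε => ?_
  obtain ⟨δ, hδ, hδε⟩ : ∃ δ : NNReal, 0 < δ ∧ (δ * C + δ * C : ℝ) ≤ ε := by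
    have hpos : 0 < ε / (2 * C + 1) := by positivity
    refine ⟨(ε / (2 * C + 1)).toNNReal, Real.toNNReal_pos.2 hpos, ?_⟩
    rw [Real.coe_toNNReal _ hpos.le]
    have : ε / (2 * C + 1) * C + ε / (2 * C + 1) * C = ε * (2 * C / (2 * C + 1)) := by ring
    rw [this]
    have : (2 * C / (2 * C + 1) : ℝ) ≤ 1 := by rw [div_le_one (by positivity)]; linarith
    nlinarith
  obtain ⟨w, hw, hwb⟩ := hva δ hδ
  have h2 := fun γ : ProbabilityMeasure Z => fun h => abs_integral_sub_le_of_enorm_le hwb (hint γ h)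
    (integrable_of_continuous hw (γ : Measure Z)) h
  have h3 : |∫ z, w z ∂(γ : Measure Z) - - φ z0| ≤ δ * C := by
    have hcl : IsClosed {x : ℝ | |x - - φ z0| ≤ δ * C} := isClosed_le (by fun_prop) (by fun_prop)
    refine hcl.mem_of_tendsto (((continuous_integral_probabilityMeasure hw).tendsto γ).comp hγ)
      (Eventually.of_forall fun n => ?_)
    have := h2 (u n) (hu n).2
    rw [(hu n).1 φ v hv h1] at this
    exact (abs_sub_comm _ _).trans_le this
  have h4 := abs_sub_le (∫ z, v z ∂(γ : Measure Z)) (∫ z, w z ∂(γ : Measure Z)) (- φ z0)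
  linarith [h2 γ hWC]

lemma ae_eq_zero_of_forall_integral_continuous (γ : Measure Z) [IsFiniteMeasure γ] {u : Z → ℝ}
    (hu : Measurable u) (hb : ∀ z, |u z| ≤ 1)
    (h : ∀ ψ : C(Z, ℝ), ∫ z, u z * ψ z ∂γ = 0) : u =ᵐ[γ] 0 := by
  have hui : Integrable u γ := Integrable.of_bound hu.aestronglyMeasurable 1 (Eventually.of_forall
      hb)
  have hmul : ∀ w : Z → ℝ, Integrable w γ → Integrable (fun z => u z * w z) γ := fun w hw =>
    hw.bdd_mul hu.aestronglyMeasurable (Eventually.of_forall hb)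
  have h0 : ∫ z, u z * u z ∂γ = 0 := by
    refine le_antisymm (le_of_forall_pos_le_add fun ε hε => ?_)
      (integral_nonneg fun z => mul_self_nonneg _)
    obtain ⟨w, hw, hwi⟩ := hui.exists_boundedContinuous_integral_sub_le hε
    have hw0 : ∫ z, u z * w z ∂γ = 0 := h w.toContinuousMap
    have h1 : ∫ z, u z * u z ∂γ = ∫ z, u z * (u z - w z) ∂γ := by
      simp_rw [mul_sub]
      rw [integral_sub (hmul _ hui) (hmul _ hwi), hw0, sub_zero]
    rw [h1, zero_add]
    refine le_trans ?_ hw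
    refine integral_mono (hmul _ (hui.sub hwi)) (hui.sub hwi).norm fun z => ?_
    rw [Real.norm_eq_abs]
    refine (le_abs_self _).trans ?_
    rw [abs_mul]
    exact mul_le_of_le_one_left (abs_nonneg _) (hb z)
  rw [integral_eq_zero_iff_of_nonneg (fun z => mul_self_nonneg _) (hmul _ hui)] at h0
  filter_upwards [h0] with z hz
  simpa using hz

lemma integral_withDensity_one_add {Z : Type*} [MeasurableSpace Z] (γ : Measure Z) {u f : Z → ℝ}
    (hu : Measurable u)
    (hb : ∀ z, |u z| ≤ 1) (hf : Integrable f γ) :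
    ∫ z, f z ∂(γ.withDensity fun z => ENNReal.ofReal (1 + u z)) =
      ∫ z, f z ∂γ + ∫ z, u z * f z ∂γ := by
  have h1 : ∀ z, 0 ≤ 1 + u z := fun z => by linarith [(abs_le.1 (hb z)).1]
  rw [integral_withDensity_eq_integral_toReal_smul (by fun_prop) (by simp)]
  rw [← integral_add hf (hf.bdd_mul hu.aestronglyMeasurable (Eventually.of_forall hb))]
  refine integral_congr_ae (Eventually.of_forall fun z => ?_)
  simp only [ENNReal.toReal_ofReal (h1 z), smul_eq_mul]
  ring

/-- Among the stationary measures with finite weight, there is one which is extremal, in the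
sense that it has no nontrivial bounded perturbation density. -/
lemma exists_extremal {E B : ℕ → Z → ℝ} (hE : ∀ k, Continuous (E k))
    (hB : ∀ k, Measurable (B k)) (hB0 : ∀ z, B 0 z = 1) (z0 : Z) {W : Z → ENNReal}
    (hW : LowerSemicontinuous W) (hWB : ∀ k, WApprox W (B k)) (γ₀ : ProbabilityMeasure Z)
    (hγ₀ : IsSol E B z0 (γ₀ : Measure Z)) (hγ₀W : ∫⁻ z, W z ∂(γ₀ : Measure Z) < ⊤) :
    ∃ γ : ProbabilityMeasure Z, IsSol E B z0 (γ : Measure Z) ∧ ∫⁻ z, W z ∂(γ : Measure Z) < ⊤ ∧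
      ∀ u : Z → ℝ, Measurable u → (∀ z, |u z| ≤ 1) →
        (∀ φ v, IsTest E B φ v → (∀ z, E 0 z = 1 → φ z = 0) → ∫ z, u z * v z ∂(γ : Measure Z) = 0) →
        u =ᵐ[(γ : Measure Z)] 0 := by
  have hγ₀W' := hγ₀W
  let d : ℕ → C(Z, ℝ) := TopologicalSpace.denseSeq C(Z, ℝ)
  let ψ : ℕ → Z → ℝ := fun i z => (1 + ‖d i‖)⁻¹ * d i z
  have hψ : ∀ i, Continuous (ψ i) := fun i => continuous_const.mul (d i).continuous
  have hψ1 : ∀ i z, |ψ i z| ≤ 1 := fun i z => by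
    have hp : 0 < 1 + ‖d i‖ := by positivity
    rw [abs_mul, abs_of_pos (inv_pos.2 hp), inv_mul_le_iff₀ hp, mul_one]
    have := (d i).norm_coe_le_norm z
    rw [Real.norm_eq_abs] at this
    linarith
  have hψi : ∀ i (γ : ProbabilityMeasure Z), Integrable (ψ i) (γ : Measure Z) := fun i γ =>
    integrable_of_continuous (hψ i) _
  have hm1 : ∀ i (γ : ProbabilityMeasure Z), |∫ z, ψ i z ∂(γ : Measure Z)| ≤ 1 := fun i γ => by
    have := norm_integral_le_of_norm_le_const (μ := (γ : Measure Z)) (f := ψ i) (C := 1)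
      (Eventually.of_forall (hψ1 i))
    simpa using this
  let R : ℕ → ProbabilityMeasure Z → ENNReal := fun i γ =>
    ENNReal.ofReal ((1 / 2) ^ i * (1 - (∫ z, ψ i z ∂(γ : Measure Z)) ^ 2))
  let Φ : ProbabilityMeasure Z → ENNReal := fun γ => ∫⁻ z, W z ∂(γ : Measure Z) + ∑' i, R i γ
  have hΦ : LowerSemicontinuous Φ := by
    refine (lowerSemicontinuous_lintegral hW).add (lowerSemicontinuous_tsum fun i => ?_)
    refine Continuous.lowerSemicontinuous (ENNReal.continuous_ofReal.comp ?_)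
    exact continuous_const.mul (continuous_const.sub ((continuous_integral_probabilityMeasure
        (hψ i)).pow 2))
  have hR : ∀ γ, ∑' i, R i γ < ⊤ := by
    intro γ
    refine lt_of_le_of_lt (ENNReal.tsum_le_tsum fun i => (?_ : R i γ ≤
        ENNReal.ofReal ((1 / 2) ^ i))) ?_
    · refine ENNReal.ofReal_le_ofReal (mul_le_of_le_one_right (by positivity) ?_)
      nlinarith [sq_nonneg (∫ z, ψ i z ∂(γ : Measure Z))]
    · rw [← ENNReal.ofReal_tsum_of_nonneg (fun i => by positivity) summable_geometric_two]
      exact ENNReal.ofReal_lt_top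
  have hΦ₀ : Φ γ₀ < ⊤ := ENNReal.add_lt_top.2 ⟨hγ₀W, hR γ₀⟩
  lift Φ γ₀ to NNReal using hΦ₀.ne with C hC
  have hK := (isClosed_setOf_isSol hE hB z0 hW hWB C).isCompact
  have hne : {γ : ProbabilityMeasure Z | IsSol E B z0 (γ : Measure Z) ∧
      ∫⁻ z, W z ∂(γ : Measure Z) ≤ C}.Nonempty := ⟨γ₀, hγ₀, by rw [hC]; exact le_self_add⟩
  obtain ⟨γ, hγK, hmin⟩ := (hΦ.lowerSemicontinuousOn _).exists_isMinOn hne hK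
  have hγW : ∫⁻ z, W z ∂(γ : Measure Z) < ⊤ := hγK.2.trans_lt ENNReal.coe_lt_top
  have hmin' : ∀ γ' : ProbabilityMeasure Z, IsSol E B z0 (γ' : Measure Z) → Φ γ ≤ Φ γ' := by
    intro γ' h'
    by_cases hc : Φ γ' ≤ C
    · exact hmin ⟨h', le_trans le_self_add hc⟩
    · have h1 : Φ γ ≤ Φ γ₀ := hmin ⟨hγ₀, by rw [hC]; exact le_self_add⟩
      rw [← hC] at h1
      exact h1.trans (not_le.1 hc).le
  refine ⟨γ, hγK.1, hγW, fun u hu hub huz => ?_⟩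
  have hvi : ∀ φ v, IsTest E B φ v → Integrable v (γ : Measure Z) := fun φ v hv =>
    (hv.wApprox hE hWB).integrable (hv.measurable hE hB) hγW
  have hu0 : ∫ z, u z ∂(γ : Measure Z) = 0 := by
    have h1 : IsTest E B (fun z => 1 - E 0 z) (fun z => 0 - B 0 z) := (IsTest.const 1).sub
        (IsTest.coord 0)
    have := huz _ _ h1 (fun z hz => by rw [hz, sub_self])
    simp_rw [hB0] at this
    simpa [integral_neg] using this
  have hui : Integrable u (γ : Measure Z) :=
    Integrable.of_bound hu.aestronglyMeasurable 1 (Eventually.of_forall hub)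
  have hpert : ∀ u : Z → ℝ, Measurable u → (∀ z, |u z| ≤ 1) → Integrable u (γ : Measure Z) → 
      ∫ z, u z ∂(γ : Measure Z) = 0 →
      (∀ φ v, IsTest E B φ v → (∀ z, E 0 z = 1 → φ z = 0) → ∫ z, u z * v z ∂(γ : Measure Z) = 0) →
      ∃ γ' : ProbabilityMeasure Z,
        (γ' : Measure Z) = (γ : Measure Z).withDensity (fun z => ENNReal.ofReal (1 + u z)) ∧
        IsSol E B z0 (γ' : Measure Z) := by
    intro u hu hub hui hu0 huz
    have hp : IsProbabilityMeasure ((γ : Measure Z).withDensity fun z =>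
        ENNReal.ofReal (1 + u z)) := by
      refine ⟨?_⟩
      rw [withDensity_apply _ MeasurableSet.univ, Measure.restrict_univ,
        ← ofReal_integral_eq_lintegral_ofReal (f := fun z => 1 + u z) ((integrable_const 1).add hui)
          (Eventually.of_forall fun z => by
            change 0 ≤ 1 + u z
            linarith [(abs_le.1 (hub z)).1]),
        integral_add (integrable_const 1) hui, hu0]
      simp
    refine ⟨⟨_, hp⟩, rfl, fun φ v hv h1 => ?_⟩
    change ∫ z, v z ∂((γ : Measure Z).withDensity fun z => ENNReal.ofReal (1 + u z)) = _
    rw [integral_withDensity_one_add _ hu hub (hvi φ v hv), huz φ v hv h1, add_zero]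
    exact hγK.1 φ v hv h1
  obtain ⟨γp, hγp, hsp⟩ := hpert u hu hub hui hu0 huz
  obtain ⟨γm, hγm, hsm⟩ := hpert (fun z => - u z) hu.neg (fun z => by rw [abs_neg]; exact hub z)
    hui.neg (by rw [integral_neg, hu0, neg_zero]) (fun φ v hv h1 => by
      simp_rw [neg_mul]
      rw [integral_neg, huz φ v hv h1, neg_zero])
  have hWsum : ∫⁻ z, W z ∂(γp : Measure Z) + ∫⁻ z, W z ∂(γm : Measure Z) =
      2 * ∫⁻ z, W z ∂(γ : Measure Z) := by
    have hWm := hW.measurable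
    rw [hγp, hγm, lintegral_withDensity_eq_lintegral_mul _ (by fun_prop) hWm,
      lintegral_withDensity_eq_lintegral_mul _ (by fun_prop) hWm, ← lintegral_add_left
          (by fun_prop),
      ← lintegral_const_mul _ hWm]
    refine lintegral_congr fun z => ?_
    simp only [Pi.mul_apply]
    rw [← add_mul, ← ENNReal.ofReal_add (by linarith [(abs_le.1 (hub z)).1])
      (by linarith [(abs_le.1 (hub z)).2])]
    congr 1
    rw [show 1 + u z + (1 + - u z) = 2 by ring]
    simp
  let q : ℕ → ℝ := fun i => ∫ z, u z * ψ i z ∂(γ : Measure Z)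
  have hRsum : ∀ i, R i γp + R i γm + ENNReal.ofReal ((1 / 2) ^ i * (2 * q i ^ 2)) = 2 * R i γ := by
    intro i
    have e1 : ∫ z, ψ i z ∂(γp : Measure Z) = ∫ z, ψ i z ∂(γ : Measure Z) + q i := by
      rw [hγp, integral_withDensity_one_add _ hu hub (hψi i γ)]
    have e2 : ∫ z, ψ i z ∂(γm : Measure Z) = ∫ z, ψ i z ∂(γ : Measure Z) - q i := by
      rw [hγm, integral_withDensity_one_add (u := fun z => - u z) _ hu.neg (fun z => by
          rw [abs_neg]; exact hub z) (hψi i γ)]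
      simp_rw [neg_mul]
      rw [integral_neg, sub_eq_add_neg]
    have hpos : ∀ γ : ProbabilityMeasure Z, 0 ≤ (1 / 2 : ℝ) ^ i * (1 - (∫ z, ψ i z ∂(γ : Measure Z))
        ^ 2) :=
      fun γ => mul_nonneg (by positivity) (by
        have := (sq_le_one_iff_abs_le_one _).2 (hm1 i γ)
        linarith)
    simp only [R]
    rw [← ENNReal.ofReal_add (hpos _) (hpos _), ← ENNReal.ofReal_add (add_nonneg (hpos _) (hpos _))
        (by positivity),
      e1, e2, show (2 : ENNReal) = ENNReal.ofReal 2 by simp, ← ENNReal.ofReal_mul (by norm_num)]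
    congr 1
    ring
  have htot : Φ γp + Φ γm + ∑' i, ENNReal.ofReal ((1 / 2) ^ i * (2 * q i ^ 2)) = 2 * Φ γ := by
    have : (∑' i, R i γp) + (∑' i, R i γm) + ∑' i, ENNReal.ofReal ((1 / 2) ^ i * (2 * q i ^ 2))
        = 2 * ∑' i, R i γ := by
      rw [← ENNReal.tsum_add, ← ENNReal.tsum_add, ← ENNReal.tsum_mul_left]
      exact tsum_congr hRsum
    simp only [Φ]
    rw [mul_add, ← hWsum, ← this]
    ring
  have hfin : Φ γ ≠ ⊤ := (ENNReal.add_lt_top.2 ⟨hγW, hR γ⟩).ne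
  have hz : ∑' i, ENNReal.ofReal ((1 / 2) ^ i * (2 * q i ^ 2)) = 0 := by
    have h1 : 2 * Φ γ + ∑' i, ENNReal.ofReal ((1 / 2) ^ i * (2 * q i ^ 2)) ≤ 2 * Φ γ + 0 := by
      rw [add_zero]
      nth_rw 2 [← htot]
      rw [two_mul]
      gcongr
      · exact hmin' _ hsp
      · exact hmin' _ hsm
    exact le_antisymm ((ENNReal.add_le_add_iff_left (ENNReal.mul_ne_top (by simp) hfin)).1 h1)
        bot_le
  have hq : ∀ i, q i = 0 := by
    intro i
    have := (ENNReal.tsum_eq_zero.1 hz) i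
    rw [ENNReal.ofReal_eq_zero] at this
    have hp : (0 : ℝ) < (1 / 2) ^ i := by positivity
    have : q i ^ 2 ≤ 0 := by nlinarith [sq_nonneg (q i)]
    exact pow_eq_zero_iff (two_ne_zero) |>.1 (le_antisymm this (sq_nonneg _))
  have hmulI : ∀ f : C(Z, ℝ), Integrable (fun z => u z * f z) (γ : Measure Z) := fun f =>
    (integrable_of_continuous f.continuous _).bdd_mul hu.aestronglyMeasurable (Eventually.of_forall
        hub)
  refine ae_eq_zero_of_forall_integral_continuous _ hu hub fun f => ?_
  have hcl : IsClosed {f : C(Z, ℝ) | ∫ z, u z * f z ∂(γ : Measure Z) = 0} := by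
    refine isClosed_eq (LipschitzWith.continuous (K := 1) (LipschitzWith.of_dist_le_mul fun f g =>
        ?_))
      continuous_const
    rw [Real.dist_eq, ← integral_sub (hmulI f) (hmulI g)]
    have := norm_integral_le_of_norm_le_const (μ := (γ : Measure Z)) (C := dist f g)
      (f := fun z => u z * f z - u z * g z) (Eventually.of_forall fun z => by
        rw [← mul_sub, norm_mul]
        calc _ ≤ 1 * dist f g := by
              gcongr
              · exact hub z
              · rw [← dist_eq_norm]; exact ContinuousMap.dist_apply_le_dist z
          _ = _ := one_mul _)
    simpa using this
  have hd : Set.range d ⊆ {f : C(Z, ℝ) | ∫ z, u z * f z ∂(γ : Measure Z) = 0} := by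
    rintro _ ⟨i, rfl⟩
    have h1 := hq i
    have hp : 0 < 1 + ‖d i‖ := by positivity
    simp only [q, ψ, mul_left_comm (u _)] at h1
    rw [integral_const_mul] at h1
    exact (mul_eq_zero.1 h1).resolve_left (inv_pos.2 hp).ne'
  exact (hcl.closure_subset_iff.2 hd) (TopologicalSpace.denseRange_denseSeq C(Z, ℝ) f)
end Extremal

/-- A stationary probability measure whose vanishing-at-the-end test derivatives are dense
in `L¹`. -/
structure IsExtremalSol {Z : Type*} [TopologicalSpace Z] [MeasurableSpace Z]
    (E B : ℕ → Z → ℝ) (z0 : Z) (γ : Measure Z) : Prop where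
  continuous_coord : ∀ k, Continuous (E k)
  field_zero : ∀ z, B 0 z = 1
  time_nonneg : ∀ z, 0 ≤ E 0 z
  time_le_one : ∀ z, E 0 z ≤ 1
  time_start : E 0 z0 = 0
  integrable : ∀ φ v, IsTest E B φ v → Integrable v γ
  isSol : IsSol E B z0 γ
  dense : ∀ h, Integrable h γ → ∀ ε : ℝ, 0 < ε → ∃ φ v, IsTest E B φ v ∧
    (∀ z, E 0 z = 1 → φ z = 0) ∧ ∫ z, |v z - h z| ∂γ < ε

/-- The value at time `s` of the observable `φ` with derivative `v`, transported from `z0`. -/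
def timeSlice {Z : Type*} [MeasurableSpace Z] (E : ℕ → Z → ℝ) (z0 : Z) (γ : Measure Z)
    (φ v : Z → ℝ) (s : ℝ) : ℝ := φ z0 + ∫ z in {z | E 0 z < s}, v z ∂γ

lemma contDiff_smoothTransition_comp {n : ℕ} (a b : ℝ) :
    ContDiff ℝ n fun t : ℝ => Real.smoothTransition (a * (b - t)) := by
  have h : ContDiff ℝ ((n : ℕ∞) : WithTop ℕ∞) Real.smoothTransition :=
      Real.smoothTransition.contDiff
  exact h.comp (contDiff_const.mul (contDiff_const.sub contDiff_id))

lemma deriv_smoothTransition_comp_nonpos {a : ℝ} (ha : 0 ≤ a) (b t : ℝ) :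
    deriv (fun t : ℝ => Real.smoothTransition (a * (b - t))) t ≤ 0 := by
  refine Antitone.deriv_nonpos fun x y hxy => Real.smoothTransition.monotone ?_
  exact mul_le_mul_of_nonneg_left (by linarith) ha

lemma deriv_smoothTransition_comp_eq_zero {a b t : ℝ} (h : a * (b - t) ≤ 0 ∨ 1 ≤ a * (b - t)) :
    deriv (fun t : ℝ => Real.smoothTransition (a * (b - t))) t = 0 := by
  rcases h with h | h
  · refine IsLocalMin.deriv_eq_zero (Eventually.of_forall fun y => ?_)
    change Real.smoothTransition (a * (b - t)) ≤ Real.smoothTransition (a * (b - y))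
    rw [Real.smoothTransition.zero_of_nonpos h]
    exact Real.smoothTransition.nonneg _
  · refine IsLocalMax.deriv_eq_zero (Eventually.of_forall fun y => ?_)
    change Real.smoothTransition (a * (b - y)) ≤ Real.smoothTransition (a * (b - t))
    rw [Real.smoothTransition.one_of_one_le h]
    exact Real.smoothTransition.le_one _

/-- A smooth approximation of the absolute value. -/
def smoothAbs (δ r : ℝ) : ℝ := √(r ^ 2 + δ ^ 2)

lemma contDiff_smoothAbs {δ : ℝ} (hδ : 0 < δ) {n : ℕ} : ContDiff ℝ n (smoothAbs δ) :=
  ((contDiff_id.pow 2).add contDiff_const).sqrt fun x => by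
    have : 0 < δ ^ 2 := by positivity
    have := sq_nonneg x
    simp only [id]
    positivity

lemma abs_le_smoothAbs (δ r : ℝ) : |r| ≤ smoothAbs δ r :=
  Real.abs_le_sqrt (by nlinarith [sq_nonneg δ])

lemma smoothAbs_zero {δ : ℝ} (hδ : 0 < δ) : smoothAbs δ 0 = δ := by
  simp [smoothAbs, Real.sqrt_sq hδ.le]

lemma abs_deriv_smoothAbs_le {δ : ℝ} (hδ : 0 < δ) (r : ℝ) : |deriv (smoothAbs δ) r| ≤ 1 := by
  have hp : 0 < r ^ 2 + δ ^ 2 := by positivity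
  have h : HasDerivAt (smoothAbs δ) (2 * r / (2 * √(r ^ 2 + δ ^ 2))) r := by
    have := ((hasDerivAt_pow 2 r).add_const (δ ^ 2)).sqrt hp.ne'
    change HasDerivAt (fun y => √(y ^ 2 + δ ^ 2)) _ r
    simpa using this
  rw [h.deriv, mul_div_mul_left _ _ two_ne_zero, abs_div, abs_of_nonneg (Real.sqrt_nonneg _)]
  exact (div_le_one (Real.sqrt_pos.2 hp)).2 (abs_le_smoothAbs δ r)

namespace IsExtremalSol
variable {Z : Type*} [MetricSpace Z] [CompactSpace Z] [MeasurableSpace Z] [BorelSpace Z]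
  {E B : ℕ → Z → ℝ} {z0 : Z} {γ : Measure Z} [IsProbabilityMeasure γ]
  {φ φ' v v' : Z → ℝ} {s : ℝ}

omit [IsProbabilityMeasure γ] in
lemma measurableSet_time_lt (H : IsExtremalSol E B z0 γ) (s : ℝ) : MeasurableSet {z | E 0 z < s} :=
  ((H.continuous_coord 0).isOpen_preimage _ isOpen_Iio).measurableSet

omit [CompactSpace Z] [IsProbabilityMeasure γ] in
lemma timeSlice_const (c s : ℝ) : timeSlice E z0 γ (fun _ => c) (fun _ => 0) s = c := by
  simp [timeSlice]

omit [IsProbabilityMeasure γ] in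
lemma timeSlice_add (H : IsExtremalSol E B z0 γ) (h : IsTest E B φ v) (h' : IsTest E B φ' v')
    (s : ℝ) : timeSlice E z0 γ (fun z => φ z + φ' z) (fun z => v z + v' z) s =
      timeSlice E z0 γ φ v s + timeSlice E z0 γ φ' v' s := by
  simp only [timeSlice]
  rw [integral_add (H.integrable _ _ h).integrableOn (H.integrable _ _ h').integrableOn]
  ring

omit [CompactSpace Z] [IsProbabilityMeasure γ] in
lemma timeSlice_const_mul (c s : ℝ) : timeSlice E z0 γ (fun z => c * φ z) (fun z => c * v z) s =
      c * timeSlice E z0 γ φ v s := by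
  simp only [timeSlice]
  rw [integral_const_mul]
  ring

omit [CompactSpace Z] [IsProbabilityMeasure γ] in
lemma timeSlice_neg (s : ℝ) : timeSlice E z0 γ (fun z => - φ z) (fun z => - v z) s =
      - timeSlice E z0 γ φ v s := by
  simp only [timeSlice]
  rw [integral_neg]
  ring

omit [IsProbabilityMeasure γ] in
lemma timeSlice_sub (H : IsExtremalSol E B z0 γ) (h : IsTest E B φ v) (h' : IsTest E B φ' v')
    (s : ℝ) : timeSlice E z0 γ (fun z => φ z - φ' z) (fun z => v z - v' z) s =
      timeSlice E z0 γ φ v s - timeSlice E z0 γ φ' v' s := by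
  simp_rw [sub_eq_add_neg]
  rw [H.timeSlice_add h h'.neg, timeSlice_neg]

omit [IsProbabilityMeasure γ] in
lemma timeSlice_eq_neg (H : IsExtremalSol E B z0 γ) (h : IsTest E B φ v)
    (h1 : ∀ z, E 0 z = 1 → φ z = 0) (s : ℝ) :
    timeSlice E z0 γ φ v s = - ∫ z in {z | E 0 z < s}ᶜ, v z ∂γ := by
  have := integral_add_compl (H.measurableSet_time_lt s) (H.integrable _ _ h)
  rw [H.isSol _ _ h h1] at this
  simp only [timeSlice]
  linarith

omit [IsProbabilityMeasure γ] in
lemma timeSlice_nonneg [IsFiniteMeasure γ] (H : IsExtremalSol E B z0 γ) (h : IsTest E B φ v)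
    (hs : 0 < s) (hs1 : s ≤ 1) {δ : ℝ} (hδ : 0 < δ)
    (hφ : ∀ z, s - δ < E 0 z → E 0 z < s → 0 ≤ φ z) : 0 ≤ timeSlice E z0 γ φ v s := by
  have hvi := H.integrable _ _ h
  let η : ℕ → ℝ → ℝ := fun n t => Real.smoothTransition (n * (s - t))
  have hη : ∀ n, ContDiff ℝ 3 (η n) := fun n => contDiff_smoothTransition_comp (n := 3) n s
  have key : ∀ᶠ n : ℕ in atTop, 0 ≤ φ z0 + ∫ z, η n (E 0 z) * v z ∂γ := by
    obtain ⟨n₀, hn₀⟩ := exists_nat_gt (max (1 / s) (1 / δ))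
    filter_upwards [eventually_ge_atTop n₀] with n hn
    have hn' : (n₀ : ℝ) ≤ n := by exact_mod_cast hn
    have hns : 1 ≤ n * s := by
      have : 1 / s < n := (le_max_left _ _).trans_lt (hn₀.trans_le hn')
      rw [div_lt_iff₀ hs] at this
      exact this.le
    have hnδ : 1 ≤ n * δ := by
      have : 1 / δ < n := (le_max_right _ _).trans_lt (hn₀.trans_le hn')
      rw [div_lt_iff₀ hδ] at this
      exact this.le
    have ht := ((IsTest.coord (E := E) (B := B) 0).comp (hη n)).mul h
    have h1 := H.isSol _ _ ht (fun z hz => by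
      rw [hz]
      simp only [η]
      rw [Real.smoothTransition.zero_of_nonpos (mul_nonpos_of_nonneg_of_nonpos (Nat.cast_nonneg n)
          (by linarith)), zero_mul])
    have hi : Integrable (fun z => η n (E 0 z) * v z) γ := by
      refine hvi.bdd_mul (c := 1) ((hη n).continuous.comp (H.continuous_coord
          0)).aestronglyMeasurable
        (Eventually.of_forall fun z => ?_)
      rw [Real.norm_eq_abs, abs_of_nonneg (Real.smoothTransition.nonneg _)]
      exact Real.smoothTransition.le_one _
    have hi2 : Integrable (fun z => φ z * (deriv (η n) (E 0 z) * B 0 z)) γ := by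
      simp_rw [H.field_zero, mul_one]
      refine integrable_of_continuous ((h.continuous H.continuous_coord).mul ?_) γ
      exact ((hη n).continuous_deriv (by norm_num)).comp (H.continuous_coord 0)
    rw [integral_add hi hi2] at h1
    have h2 : ∫ z, φ z * (deriv (η n) (E 0 z) * B 0 z) ∂γ ≤ 0 := by
      refine integral_nonpos fun z => ?_
      simp only [H.field_zero, mul_one, Pi.zero_apply]
      by_cases hz : (n : ℝ) * (s - E 0 z) ≤ 0 ∨ 1 ≤ n * (s - E 0 z)
      · rw [show deriv (η n) (E 0 z) = 0 from deriv_smoothTransition_comp_eq_zero hz, mul_zero]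
      · push Not at hz
        refine mul_nonpos_of_nonneg_of_nonpos (hφ z ?_ ?_)
          (deriv_smoothTransition_comp_nonpos (Nat.cast_nonneg n) s _)
        · by_contra hcon
          nlinarith [hz.2, (Nat.cast_nonneg n : (0 : ℝ) ≤ n)]
        · by_contra hcon
          nlinarith [hz.1, (Nat.cast_nonneg n : (0 : ℝ) ≤ n)]
    have h3 : η n (E 0 z0) = 1 := by
      simp only [η, H.time_start, sub_zero]
      exact Real.smoothTransition.one_of_one_le hns
    rw [h3, one_mul] at h1
    linarith
  have hlim : Tendsto (fun n : ℕ => φ z0 + ∫ z, η n (E 0 z) * v z ∂γ) atTop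
      (𝓝 (timeSlice E z0 γ φ v s)) := by
    refine Tendsto.const_add _ ?_
    rw [← integral_indicator (H.measurableSet_time_lt s)]
    refine tendsto_integral_of_dominated_convergence (fun z => |v z|) (fun n => ?_) hvi.abs
      (fun n => Eventually.of_forall fun z => ?_) (Eventually.of_forall fun z => ?_)
    · exact ((hη n).continuous.comp (H.continuous_coord 0)).aestronglyMeasurable.mul hvi.1
    · rw [norm_mul, Real.norm_eq_abs, Real.norm_eq_abs, abs_of_nonneg (Real.smoothTransition.nonneg
        _)]
      exact mul_le_of_le_one_left (abs_nonneg _) (Real.smoothTransition.le_one _)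
    · by_cases hz : E 0 z < s
      · rw [Set.indicator_of_mem (by exact hz)]
        refine tendsto_const_nhds.congr' ?_
        obtain ⟨n₀, hn₀⟩ := exists_nat_gt (1 / (s - E 0 z))
        filter_upwards [eventually_ge_atTop n₀] with n hn
        have hn' : (n₀ : ℝ) ≤ n := by exact_mod_cast hn
        have : 1 / (s - E 0 z) < n := hn₀.trans_le hn'
        rw [div_lt_iff₀ (by linarith)] at this
        simp only [η]
        rw [Real.smoothTransition.one_of_one_le this.le, one_mul]
      · rw [Set.indicator_of_notMem (by exact hz)]
        refine tendsto_const_nhds.congr fun n => ?_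
        simp only [η]
        rw [Real.smoothTransition.zero_of_nonpos (mul_nonpos_of_nonneg_of_nonpos (Nat.cast_nonneg n)
            (by linarith)), zero_mul]
  exact ge_of_tendsto hlim key

omit [IsProbabilityMeasure γ] in
lemma timeSlice_mono [IsFiniteMeasure γ] (H : IsExtremalSol E B z0 γ) (h : IsTest E B φ v)
    (h' : IsTest E B φ' v') (hs : 0 < s) (hs1 : s ≤ 1) {δ : ℝ} (hδ : 0 < δ)
    (hφ : ∀ z, s - δ < E 0 z → E 0 z < s → φ z ≤ φ' z) :
    timeSlice E z0 γ φ v s ≤ timeSlice E z0 γ φ' v' s := by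
  have := H.timeSlice_nonneg (h'.sub h) hs hs1 hδ fun z h1 h2 => sub_nonneg.2 (hφ z h1 h2)
  rw [H.timeSlice_sub h' h] at this
  linarith

lemma setIntegral_le_of_deriv_bound {S : Set Z} (hS : MeasurableSet S) {v x h : Z → ℝ}
    {β : Z → ℝ} (hv : Integrable (fun z => v z - h z) γ) (hβ : ∀ z, |β z| ≤ 1)
    (hx : ∀ z ∈ S, x z = v z - h z) {ε : ℝ} (hε : ∫ z, |v z - h z| ∂γ ≤ ε) :
    |∫ z in S, β z * x z ∂γ| ≤ ε := by
  have h1 : |∫ z in S, β z * x z ∂γ| ≤ ∫ z in S, |v z - h z| ∂γ := by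
    rw [← Real.norm_eq_abs]
    refine norm_integral_le_of_norm_le hv.abs.integrableOn ?_
    filter_upwards [ae_restrict_mem hS] with z hz
    rw [hx z hz, norm_mul]
    exact mul_le_of_le_one_left (norm_nonneg _) (hβ z)
  refine h1.trans (le_trans ?_ hε)
  exact setIntegral_le_integral hv.abs (Eventually.of_forall fun _ => abs_nonneg _)

/-- Observables are deterministic on each time slice. -/
lemma timeSlice_sq (H : IsExtremalSol E B z0 γ) (h : IsTest E B φ v) (hs : 0 < s) (hs1 : s < 1) :
    timeSlice E z0 γ (fun z => (φ z - timeSlice E z0 γ φ v s) * (φ z - timeSlice E z0 γ φ v s))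
      (fun z => (φ z - timeSlice E z0 γ φ v s) * v z + (φ z - timeSlice E z0 γ φ v s) * v z) s =
          0 := by
  set m := timeSlice E z0 γ φ v s with hm
  let lam : ℝ → ℝ := fun t => Real.smoothTransition ((1 - s)⁻¹ * (1 - t))
  have hlam : ContDiff ℝ 3 lam := contDiff_smoothTransition_comp (n := 3) _ _
  have h1s : 0 < 1 - s := by linarith
  have hχ := ((IsTest.coord (E := E) (B := B) 0).comp hlam).mul h
  set χ := fun z => lam (E 0 z) * φ z with hχdef
  set x := fun z => lam (E 0 z) * v z + φ z * (deriv lam (E 0 z) * B 0 z) with hx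
  have hχs : ∀ z, E 0 z < s → χ z = φ z := by
    intro z hz
    simp only [χ, lam]
    rw [Real.smoothTransition.one_of_one_le, one_mul]
    rw [inv_mul_eq_div, one_le_div h1s]
    linarith
  have hχ1 : ∀ z, E 0 z = 1 → χ z = 0 := by
    intro z hz
    simp only [χ, lam, hz, sub_self, mul_zero, Real.smoothTransition.zero, zero_mul]
  let S := {z | E 0 z < s}
  have hS : MeasurableSet S := H.measurableSet_time_lt s
  let h' : Z → ℝ := Sᶜ.indicator x
  have hxi := H.integrable _ _ hχ
  have hh'i : Integrable h' γ := hxi.indicator hS.compl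
  obtain ⟨M, hM⟩ := isCompact_univ.exists_bound_of_continuousOn
    (h.continuous H.continuous_coord).continuousOn
  have hsq := (h.sub (IsTest.const m)).mul (h.sub (IsTest.const m))
  have hcongr : timeSlice E z0 γ (fun z => (φ z - m) * (φ z - m))
      (fun z => (φ z - m) * v z + (φ z - m) * v z) s = timeSlice E z0 γ (fun z =>
          (φ z - m) * (φ z - m))
      (fun z => (φ z - m) * (v z - 0) + (φ z - m) * (v z - 0)) s := by simp only [sub_zero]
  rw [hcongr]
  refine le_antisymm (le_of_forall_pos_le_add fun ε' hε' => ?_)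
    (H.timeSlice_nonneg hsq hs hs1.le one_pos fun z _ _ => mul_self_nonneg _)
  have hL : 0 < M + |m| + 1 := by
    have := (norm_nonneg _).trans (hM z0 trivial); positivity
  set L := M + |m| + 1 with hLdef
  set ε := ε' / (8 * L) with hεdef
  have hε : 0 < ε := by positivity
  obtain ⟨ψ, w, hψ, hψ1, hψε⟩ := H.dense h' hh'i ε hε
  set c := ψ z0
  have hwi := H.integrable _ _ hψ
  -- forward estimate
  have ht1 := (hψ.sub (IsTest.const c)).comp (contDiff_smoothAbs hε (n := 3))
  set P := timeSlice E z0 γ (fun z => smoothAbs ε (ψ z - c))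
    (fun z => deriv (smoothAbs ε) (ψ z - c) * (w z - 0)) s with hPdef
  have hP : P ≤ 2 * ε := by
    have := setIntegral_le_of_deriv_bound (x := fun z => w z - 0) hS (hwi.sub hh'i)
      (fun z => abs_deriv_smoothAbs_le hε (ψ z - c)) (fun z hz => by
        simp only [h']
        rw [Set.indicator_of_notMem (by simpa using hz)]) hψε.le
    simp only [P, timeSlice]
    rw [show ψ z0 - c = 0 from sub_self _, smoothAbs_zero hε]
    linarith [le_abs_self (∫ z in S, deriv (smoothAbs ε) (ψ z - c) * (w z - 0) ∂γ)]
  -- backward estimate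
  have ht2 := (hψ.sub hχ).comp (contDiff_smoothAbs hε (n := 3))
  set Q := timeSlice E z0 γ (fun z => smoothAbs ε (ψ z - χ z))
    (fun z => deriv (smoothAbs ε) (ψ z - χ z) * (w z - x z)) s with hQdef
  have hQ : Q ≤ 2 * ε := by
    have h1 := H.timeSlice_eq_neg (ht2.sub (IsTest.const ε)) (fun z hz => by
      rw [hψ1 z hz, hχ1 z hz, sub_zero, smoothAbs_zero hε, sub_self]) s
    rw [H.timeSlice_sub ht2 (IsTest.const ε), timeSlice_const] at h1
    have := setIntegral_le_of_deriv_bound (x := fun z => w z - x z) hS.compl (hwi.sub hh'i)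
      (fun z => abs_deriv_smoothAbs_le hε (ψ z - χ z)) (fun z hz => by
        simp only [h']
        rw [Set.indicator_of_mem hz]) hψε.le
    simp only [sub_zero] at h1
    linarith [neg_abs_le (∫ z in Sᶜ, deriv (smoothAbs ε) (ψ z - χ z) * (w z - x z) ∂γ)]
  have hdist : ∀ z, E 0 z < s → |φ z - c| ≤ smoothAbs ε (ψ z - χ z) + smoothAbs ε (ψ z - c) := by
    intro z hz
    have e1 := abs_le_smoothAbs ε (ψ z - χ z)
    have e2 := abs_le_smoothAbs ε (ψ z - c)
    rw [hχs z hz] at e1 ⊢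
    have := abs_sub_le (φ z) (ψ z) c
    rw [abs_sub_comm (φ z) (ψ z)] at this
    linarith
  have hmc : |m - c| ≤ 4 * ε := by
    have a1 := H.timeSlice_mono (h.sub (IsTest.const c)) (ht2.add ht1) hs hs1.le one_pos
      (fun z _ hz => (le_abs_self _).trans (hdist z hz))
    have a2 := H.timeSlice_mono (h.sub (IsTest.const c)).neg (ht2.add ht1) hs hs1.le one_pos
      (fun z _ hz => (neg_le_abs _).trans (hdist z hz))
    rw [timeSlice_neg] at a2
    rw [H.timeSlice_sub h (IsTest.const c), timeSlice_const, H.timeSlice_add ht2 ht1] at a1 a2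
    rw [abs_le]
    constructor <;> linarith
  have ht3 := ((ht2.add ht1).add (IsTest.const |m - c|)).const_mul L
  have a3 := H.timeSlice_mono hsq ht3 hs hs1.le one_pos (fun z _ hz => by
    have b1 : |φ z - m| ≤ smoothAbs ε (ψ z - χ z) + smoothAbs ε (ψ z - c) + |m - c| := by
      have := abs_sub_le (φ z) c m
      rw [abs_sub_comm c m] at this
      linarith [hdist z hz]
    have b2 : |φ z - m| ≤ L := by
      have := hM z trivial
      rw [Real.norm_eq_abs] at this
      have := abs_sub (φ z) m
      linarith
    rw [← abs_mul_abs_self]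
    exact mul_le_mul b2 b1 (abs_nonneg _) hL.le)
  rw [timeSlice_const_mul, H.timeSlice_add (ht2.add ht1) (IsTest.const _), timeSlice_const,
    H.timeSlice_add ht2 ht1] at a3
  have : L * (Q + P + |m - c|) ≤ L * (8 * ε) := by
    refine mul_le_mul_of_nonneg_left ?_ hL.le
    linarith
  have e : L * (8 * ε) = ε' := by rw [hεdef]; field_simp
  linarith

end IsExtremalSol

lemma ContinuousMap.continuous_integral_finiteMeasure {Z : Type*} [MetricSpace Z]
    [CompactSpace Z] [MeasurableSpace Z] [BorelSpace Z] (μ : Measure Z) [IsFiniteMeasure μ] :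
    Continuous fun f : C(Z, ℝ) => ∫ z, f z ∂μ := by
  refine (continuous_integral.comp (ContinuousMap.toLp 1 μ ℝ (E := ℝ)).continuous).congr fun f => ?_
  exact integral_congr_ae (ContinuousMap.coeFn_toLp (p := 1) (𝕜 := ℝ) μ f)

namespace IsExtremalSol
variable {Z : Type*} [MetricSpace Z] [CompactSpace Z] [MeasurableSpace Z] [BorelSpace Z]
  {E B : ℕ → Z → ℝ} {z0 : Z} {γ : Measure Z} [IsProbabilityMeasure γ]
  {φ φ' v v' : Z → ℝ} {s : ℝ}

lemma timeSlice_time (H : IsExtremalSol E B z0 γ) (hs : 0 < s) (hs1 : s ≤ 1) :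
    timeSlice E z0 γ (E 0) (B 0) s = s := by
  refine le_antisymm ?_ (le_of_forall_sub_le fun ε hε => ?_)
  · have := H.timeSlice_mono (IsTest.coord 0) (IsTest.const s) hs hs1 one_pos
      fun z _ hz => hz.le
    rwa [timeSlice_const] at this
  · have := H.timeSlice_mono (IsTest.const (s - ε)) (IsTest.coord 0) hs hs1 hε
      fun z hz _ => hz.le
    rwa [timeSlice_const] at this

lemma measureReal_time_lt (H : IsExtremalSol E B z0 γ) (s : ℝ) :
    γ.real {z | E 0 z < s} = max 0 (min s 1) := by
  rcases le_or_gt s 0 with hs | hs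
  · rw [show {z | E 0 z < s} = ∅ from Set.eq_empty_of_forall_notMem fun z hz =>
      (hz.trans_le hs).not_ge (H.time_nonneg z), measureReal_empty, max_eq_left]
    exact (min_le_left _ _).trans hs
  rcases le_or_gt s 1 with hs1 | hs1
  · have := H.timeSlice_time hs hs1
    simp only [timeSlice, H.field_zero, H.time_start, integral_const, smul_eq_mul, mul_one,
      zero_add, measureReal_restrict_apply_univ] at this
    rw [this, min_eq_left hs1, max_eq_right hs.le]
  · rw [show {z | E 0 z < s} = Set.univ from Set.eq_univ_of_forall fun z =>
      (H.time_le_one z).trans_lt hs1, probReal_univ, min_eq_right hs1.le, max_eq_right zero_le_one]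

lemma ae_time_ne (H : IsExtremalSol E B z0 γ) (s : ℝ) : ∀ᵐ z ∂γ, E 0 z ≠ s := by
  rw [ae_iff, ← measureReal_eq_zero_iff]
  refine le_antisymm (le_of_forall_pos_le_add fun ε hε => ?_) measureReal_nonneg
  have h1 : {z | ¬ E 0 z ≠ s} ⊆ {z | E 0 z < s + ε} \ {z | E 0 z < s} := by
    intro z hz
    have hz : E 0 z = s := not_not.1 hz
    exact ⟨by change E 0 z < s + ε; linarith, fun h => h.ne hz⟩
  refine (measureReal_mono h1).trans ?_
  have h3 : {z | E 0 z < s} ⊆ {z | E 0 z < s + ε} := fun z (hz : E 0 z < s) => by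
    change E 0 z < s + ε
    linarith
  rw [measureReal_sdiff h3 (H.measurableSet_time_lt s), H.measureReal_time_lt,
      H.measureReal_time_lt]
  have : min (s + ε) 1 ≤ min s 1 + ε := by
    rcases le_total s 1 with h | h
    · rw [min_eq_left h]; exact min_le_left _ _
    · rw [min_eq_right h]; exact (min_le_right _ _).trans (by linarith)
  have h2 : max 0 (min (s + ε) 1) ≤ max 0 (min s 1) + ε :=
    max_le (by positivity) (this.trans (by gcongr; exact le_max_right _ _))
  linarith

lemma continuous_timeSlice (H : IsExtremalSol E B z0 γ) (h : IsTest E B φ v) :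
    Continuous (timeSlice E z0 γ φ v) := by
  have hv := H.integrable _ _ h
  refine continuous_const.add ?_
  simp_rw [← integral_indicator (H.measurableSet_time_lt _)]
  rw [continuous_iff_continuousAt]
  intro s
  refine continuousAt_of_dominated (bound := fun z => ‖v z‖)
    (Eventually.of_forall fun t => (hv.indicator (H.measurableSet_time_lt t)).1)
    (Eventually.of_forall fun t => Eventually.of_forall fun z => norm_indicator_le_norm_self _ _)
    hv.norm ?_
  filter_upwards [H.ae_time_ne s] with z hz
  rcases lt_or_gt_of_ne hz with hz | hz
  · refine (continuousAt_const (y := v z)).congr ?_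
    filter_upwards [lt_mem_nhds hz] with t ht
    rw [Set.indicator_of_mem (by exact ht)]
  · refine (continuousAt_const (y := (0 : ℝ))).congr ?_
    filter_upwards [gt_mem_nhds hz] with t ht
    rw [Set.indicator_of_notMem (s := {z | E 0 z < t}) (fun h => (ht.trans h).false)]

lemma exists_nonneg_test (H : IsExtremalSol E B z0 γ) (h : IsTest E B φ v) (hs : 0 < s)
    (hs1 : s < 1) (n : ℕ) : ∃ q w, IsTest E B q w ∧ (∀ z, 0 ≤ q z) ∧ timeSlice E z0 γ q w s = 0 ∧
      ∀ z, q z = 0 → (∀ j < n, E j z = timeSlice E z0 γ (E j) (B j) s) ∧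
        φ z = timeSlice E z0 γ φ v s := by
  induction n with
  | zero =>
    have h2 := (h.sub (IsTest.const (timeSlice E z0 γ φ v s))).mul
      (h.sub (IsTest.const (timeSlice E z0 γ φ v s)))
    refine ⟨_, _, h2, fun z => mul_self_nonneg _, by simpa using H.timeSlice_sq h hs hs1,
      fun z hz => ⟨fun j hj => absurd hj (by simp), sub_eq_zero.1 (mul_self_eq_zero.1 hz)⟩⟩
  | succ n ih =>
    obtain ⟨q, w, hq, hq0, hqs, hqz⟩ := ih
    have hn : IsTest E B (E n) (B n) := IsTest.coord n
    have hn2 := (hn.sub (IsTest.const (timeSlice E z0 γ (E n) (B n) s))).mul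
      (hn.sub (IsTest.const (timeSlice E z0 γ (E n) (B n) s)))
    refine ⟨_, _, hq.add hn2, fun z => add_nonneg (hq0 z) (mul_self_nonneg _), ?_, fun z hz => ?_⟩
    · rw [H.timeSlice_add hq hn2, hqs]
      simpa using H.timeSlice_sq hn hs hs1
    · rw [add_eq_zero_iff_of_nonneg (hq0 z) (mul_self_nonneg _)] at hz
      obtain ⟨h1, h2⟩ := hqz z hz.1
      refine ⟨fun j hj => ?_, h2⟩
      rcases Nat.lt_succ_iff_lt_or_eq.1 hj with hj | rfl
      · exact h1 j hj
      · exact sub_eq_zero.1 (mul_self_eq_zero.1 hz.2)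

lemma exists_point (H : IsExtremalSol E B z0 γ) (h : IsTest E B φ v) (hs : 0 < s)
    (hs1 : s < 1) : ∃ z, (∀ j, E j z = timeSlice E z0 γ (E j) (B j) s) ∧
        φ z = timeSlice E z0 γ φ v s := by
  let K : ℕ → Set Z := fun n => {z | (∀ j < n, E j z = timeSlice E z0 γ (E j) (B j) s) ∧
        φ z = timeSlice E z0 γ φ v s}
  have hK : ∀ n, IsClosed (K n) := by
    intro n
    have : K n = (⋂ j, ⋂ (_ : j < n), {z | E j z = timeSlice E z0 γ (E j) (B j) s}) ∩
        {z | φ z = timeSlice E z0 γ φ v s} := by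
      ext z; simp [K]
    rw [this]
    exact (isClosed_iInter fun j => isClosed_iInter fun _ =>
      isClosed_eq (H.continuous_coord j) continuous_const).inter
      (isClosed_eq (h.continuous H.continuous_coord) continuous_const)
  have hne : ∀ n, (K n).Nonempty := by
    intro n
    obtain ⟨q, w, hq, hq0, hqs, hqz⟩ := H.exists_nonneg_test h hs hs1 n
    obtain ⟨z, -, hz⟩ := isCompact_univ.exists_isMinOn ⟨z0, trivial⟩
      (hq.continuous H.continuous_coord).continuousOn
    refine ⟨z, hqz z (le_antisymm ?_ (hq0 z))⟩
    have := H.timeSlice_mono (IsTest.const (q z)) hq hs hs1.le one_pos fun y _ _ => hz trivial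
    rwa [timeSlice_const, hqs] at this
  obtain ⟨z, hz⟩ := IsCompact.nonempty_iInter_of_sequence_nonempty_isCompact_isClosed K
    (fun n z hz => ⟨fun j hj => hz.1 j (hj.trans n.lt_succ_self), hz.2⟩) hne
    (hK 0).isCompact hK
  rw [Set.mem_iInter] at hz
  exact ⟨z, fun j => (hz (j + 1)).1 j j.lt_succ_self, (hz 0).2⟩

lemma timeSlice_zero (H : IsExtremalSol E B z0 γ) : timeSlice E z0 γ φ v 0 = φ z0 := by
  rw [timeSlice, show {z | E 0 z < 0} = ∅ from Set.eq_empty_of_forall_notMem fun z hz =>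
      (not_lt.2 (H.time_nonneg z)) hz, Measure.restrict_empty, integral_zero_measure, add_zero]

lemma exists_curve (H : IsExtremalSol E B z0 γ) (hsep : ∀ z z', (∀ j, E j z = E j z') → z = z') :
    ∃ ζ : ℝ → Z, Continuous ζ ∧ ζ 0 = z0 ∧
      (∀ s ∈ Set.Icc (0 : ℝ) 1, ∀ j, E j (ζ s) = timeSlice E z0 γ (E j) (B j) s) ∧
      ∀ φ v, IsTest E B φ v → ∀ s ∈ Set.Icc (0 : ℝ) 1, φ (ζ s) = timeSlice E z0 γ φ v s := by
  have hcont : Continuous fun z j => E j z := continuous_pi H.continuous_coord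
  have hcl : IsClosedEmbedding fun z j => E j z :=
    hcont.isClosedEmbedding fun z z' h => hsep z z' fun j => congrFun h j
  let M : ℝ → ℕ → ℝ := fun s j => timeSlice E z0 γ (E j) (B j) s
  have hM : Continuous M := continuous_pi fun j => H.continuous_timeSlice (IsTest.coord j)
  have hpre : Set.Icc (0 : ℝ) 1 ⊆ M ⁻¹' Set.range fun z j => E j z := by
    rw [← closure_Ioo zero_ne_one]
    refine closure_minimal (fun s hs => ?_) (hcl.isClosed_range.preimage hM)
    obtain ⟨z, hz, -⟩ := H.exists_point (IsTest.const 0) hs.1 hs.2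
    exact ⟨z, funext hz⟩
  let c : ℝ → ℝ := fun s => max 0 (min s 1)
  have hc : ∀ s, c s ∈ Set.Icc (0 : ℝ) 1 := fun s =>
    ⟨le_max_left _ _, max_le zero_le_one (min_le_right _ _)⟩
  have hcs : ∀ s ∈ Set.Icc (0 : ℝ) 1, c s = s := fun s hs => by
    simp only [c]
    rw [min_eq_left hs.2, max_eq_right hs.1]
  choose ζ hζ using fun s => hpre (hc s)
  have hζc : Continuous ζ := by
    rw [hcl.isInducing.continuous_iff]
    rw [show (fun z j => E j z) ∘ ζ = M ∘ c from funext hζ]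
    exact hM.comp (by fun_prop)
  have hζM : ∀ s ∈ Set.Icc (0 : ℝ) 1, ∀ j, E j (ζ s) = timeSlice E z0 γ (E j) (B j) s :=
    fun s hs j => by
      have := congrFun (hζ s) j
      rwa [hcs s hs] at this
  refine ⟨ζ, hζc, hsep _ _ fun j => ?_, hζM, fun φ v h => ?_⟩
  · rw [hζM 0 (by simp), H.timeSlice_zero]
  · have : Set.Icc (0 : ℝ) 1 ⊆ {s | φ (ζ s) = timeSlice E z0 γ φ v s} := by
      rw [← closure_Ioo zero_ne_one]
      refine closure_minimal (fun s hs => ?_) (isClosed_eq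
        ((h.continuous H.continuous_coord).comp hζc) (H.continuous_timeSlice h))
      obtain ⟨z, hz, hz2⟩ := H.exists_point h hs.1 hs.2
      have e : ζ s = z := hsep _ _ fun j => by rw [hζM s (Set.Ioo_subset_Icc_self hs), hz]
      change φ (ζ s) = _
      rw [e, hz2]
    exact fun s hs => this hs

lemma integral_test (H : IsExtremalSol E B z0 γ) (h : IsTest E B φ v) :
    ∫ z, φ z ∂γ = ∫ s in Set.Ioc (0 : ℝ) 1, timeSlice E z0 γ φ v s := by
  have hv := H.integrable _ _ h
  have h1 := H.isSol _ _ (((IsTest.const 1).sub (IsTest.coord 0)).mul h) fun z hz => by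
    rw [hz, sub_self, zero_mul]
  have hφ := integrable_of_continuous (h.continuous H.continuous_coord) γ
  have hi : Integrable (fun z => (1 - E 0 z) * v z) γ := by
    refine hv.bdd_mul (c := 1) (continuous_const.sub (H.continuous_coord 0)).aestronglyMeasurable
      (Eventually.of_forall fun z => ?_)
    rw [Real.norm_eq_abs, abs_le]
    constructor <;> linarith [H.time_nonneg z, H.time_le_one z]
  simp only [H.field_zero, H.time_start, sub_zero, one_mul, zero_sub, mul_neg, mul_one] at h1
  rw [integral_add hi (by exact hφ.neg), integral_neg] at h1
  have hprod : Integrable (fun p : ℝ × Z => {z | E 0 z < p.1}.indicator v p.2)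
      ((volume.restrict (Set.Ioc (0 : ℝ) 1)).prod γ) := by
    have : (fun p : ℝ × Z => {z | E 0 z < p.1}.indicator v p.2) =
        {p : ℝ × Z | E 0 p.2 < p.1}.indicator fun p => v p.2 := rfl
    rw [this]
    refine (hv.comp_snd _).indicator ?_
    exact measurableSet_lt ((H.continuous_coord 0).measurable.comp measurable_snd) measurable_fst
  have h2 : ∫ s in Set.Ioc (0 : ℝ) 1, ∫ z in {z | E 0 z < s}, v z ∂γ =
      ∫ z, (1 - E 0 z) * v z ∂γ := by
    simp_rw [← integral_indicator (H.measurableSet_time_lt _)]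
    rw [integral_integral_swap (f := fun s z => {z | E 0 z < s}.indicator v z) hprod]
    refine integral_congr_ae (Eventually.of_forall fun z => ?_)
    have e : ∀ s, {z | E 0 z < s}.indicator v z = (Set.Ioi (E 0 z)).indicator (fun _ => v z) s :=
      fun s => rfl
    simp_rw [e]
    rw [setIntegral_indicator measurableSet_Ioi, setIntegral_const, Set.Ioc_inter_Ioi,
      max_eq_right (H.time_nonneg z), measureReal_def, Real.volume_Ioc,
      ENNReal.toReal_ofReal (by linarith [H.time_le_one z]), smul_eq_mul]
  have h3 : Integrable (fun s => ∫ z in {z | E 0 z < s}, v z ∂γ) (volume.restrict (Set.Ioc (0 : ℝ)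
      1)) := by
    simp_rw [← integral_indicator (H.measurableSet_time_lt _)]
    exact hprod.integral_prod_left
  simp only [timeSlice]
  rw [integral_add (by simp) h3, h2]
  simp
  linarith

/-- An extremal solution is carried by a single curve. -/
theorem eq_map_curve (H : IsExtremalSol E B z0 γ) (hsep : ∀ z z', (∀ j, E j z = E j z') → z = z') :
    ∃ ζ : ℝ → Z, Continuous ζ ∧ ζ 0 = z0 ∧ (∀ s ∈ Set.Icc (0 : ℝ) 1, E 0 (ζ s) = s) ∧
      γ = (volume.restrict (Set.Ioc (0 : ℝ) 1)).map ζ ∧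
      ∀ j, IntegrableOn (fun s => B j (ζ s)) (Set.Ioc (0 : ℝ) 1) ∧
        ∀ s ∈ Set.Icc (0 : ℝ) 1, E j (ζ s) = E j z0 + ∫ r in (0 : ℝ)..s, B j (ζ r) := by
  obtain ⟨ζ, hζc, hζ0, hζM, hζφ⟩ := H.exists_curve hsep
  have htime : ∀ s ∈ Set.Icc (0 : ℝ) 1, E 0 (ζ s) = s := by
    intro s hs
    rcases hs.1.eq_or_lt with rfl | hs0
    · rw [hζ0, H.time_start]
    · rw [hζM s hs, H.timeSlice_time hs0 hs.2]
  have hν : IsProbabilityMeasure (volume.restrict (Set.Ioc (0 : ℝ) 1)) := ⟨by simp⟩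
  have hmap : γ = (volume.restrict (Set.Ioc (0 : ℝ) 1)).map ζ := by
    have := Measure.isProbabilityMeasure_map (μ := volume.restrict (Set.Ioc (0 : ℝ) 1))
        hζc.aemeasurable
    let A : Subalgebra ℝ C(Z, ℝ) :=
      { carrier := {f | ∃ v, IsTest E B f v}
        mul_mem' := fun ⟨_, h⟩ ⟨_, h'⟩ => ⟨_, h.mul h'⟩
        add_mem' := fun ⟨_, h⟩ ⟨_, h'⟩ => ⟨_, h.add h'⟩
        algebraMap_mem' := fun r => ⟨_, IsTest.const r⟩ }
    have hA : A.topologicalClosure = ⊤ := by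
      refine ContinuousMap.subalgebra_topologicalClosure_eq_top_of_separatesPoints A fun z z' hne =>
          ?_
      by_contra! hcon
      exact hne (hsep z z' fun j => hcon (E j) ⟨⟨E j, H.continuous_coord j⟩, ⟨_, IsTest.coord j⟩,
          rfl⟩)
    refine ext_of_forall_integral_eq_of_IsFiniteMeasure fun f => ?_
    have hclosed : IsClosed {f : C(Z, ℝ) | ∫ z, f z ∂γ =
        ∫ z, f z ∂((volume.restrict (Set.Ioc (0 : ℝ) 1)).map ζ)} := by
      refine isClosed_eq (ContinuousMap.continuous_integral_finiteMeasure _)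
          (ContinuousMap.continuous_integral_finiteMeasure _)
    have hsub : (A : Set C(Z, ℝ)) ⊆ {f : C(Z, ℝ) | ∫ z, f z ∂γ =
        ∫ z, f z ∂((volume.restrict (Set.Ioc (0 : ℝ) 1)).map ζ)} := by
      rintro f ⟨v, h⟩
      change ∫ z, f z ∂γ = ∫ z, f z ∂((volume.restrict (Set.Ioc (0 : ℝ) 1)).map ζ)
      rw [H.integral_test h, integral_map hζc.aemeasurable f.continuous.aestronglyMeasurable]
      exact setIntegral_congr_fun measurableSet_Ioc fun s hs =>
        (hζφ f v h s (Set.Ioc_subset_Icc_self hs)).symm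
    have := closure_minimal hsub hclosed
    rw [← Subalgebra.topologicalClosure_coe, hA] at this
    exact this (show f.toContinuousMap ∈ ((⊤ : Subalgebra ℝ C(Z, ℝ)) : Set C(Z, ℝ)) from trivial)
  refine ⟨ζ, hζc, hζ0, htime, hmap, fun j => ?_⟩
  have hBj := H.integrable _ _ (IsTest.coord j)
  have hBm : AEStronglyMeasurable (B j) ((volume.restrict (Set.Ioc (0 : ℝ) 1)).map ζ) :=
      hmap ▸ hBj.1
  refine ⟨?_, fun s hs => ?_⟩
  · rw [hmap] at hBj
    exact hBj.comp_aemeasurable hζc.aemeasurable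
  · rw [hζM s hs, timeSlice, intervalIntegral.integral_of_le hs.1]
    congr 1
    have hms := H.measurableSet_time_lt s
    rw [hmap] at hBj ⊢
    rw [setIntegral_map hms hBm hζc.aemeasurable,
      Measure.restrict_restrict (hζc.measurable hms)]
    have : ζ ⁻¹' {z | E 0 z < s} ∩ Set.Ioc 0 1 = Set.Ioo 0 s := by
      ext r
      constructor
      · rintro ⟨h1, h2⟩
        have h1 : E 0 (ζ r) < s := h1
        rw [htime r (Set.Ioc_subset_Icc_self h2)] at h1
        exact ⟨h2.1, h1⟩
      · rintro ⟨h1, h2⟩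
        have h3 : r ∈ Set.Ioc (0 : ℝ) 1 := ⟨h1, h2.le.trans hs.2⟩
        exact ⟨by change E 0 (ζ r) < s; rwa [htime r (Set.Ioc_subset_Icc_self h3)], h3⟩
    rw [this, integral_Ioc_eq_integral_Ioo]

end IsExtremalSol

/-- Superposition: a stationary measure with integrable field yields an integral curve. -/
theorem exists_integralCurve {Z : Type*} [MetricSpace Z] [CompactSpace Z] [MeasurableSpace Z]
    [BorelSpace Z] {E B : ℕ → Z → ℝ} (hE : ∀ k, Continuous (E k)) (hB : ∀ k, Measurable (B k))
    (hB0 : ∀ z, B 0 z = 1) (hE0 : ∀ z, 0 ≤ E 0 z) (hE1 : ∀ z, E 0 z ≤ 1)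
    (hsep : ∀ z z', (∀ j, E j z = E j z') → z = z') (z0 : Z) (hz0 : E 0 z0 = 0)
    {N : Z → ENNReal} (hN : Measurable N) (γ₀ : ProbabilityMeasure Z)
    (hγ₀ : IsSol E B z0 (γ₀ : Measure Z)) (hBi : ∀ k, Integrable (B k) (γ₀ : Measure Z))
    (hNi : ∫⁻ z, N z ∂(γ₀ : Measure Z) < ⊤) :
    ∃ ζ : ℝ → Z, Continuous ζ ∧ ζ 0 = z0 ∧ (∀ s ∈ Set.Icc (0 : ℝ) 1, E 0 (ζ s) = s) ∧
      (∫⁻ s in Set.Ioc (0 : ℝ) 1, N (ζ s) < ⊤) ∧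
      ∀ j, IntegrableOn (fun s => B j (ζ s)) (Set.Ioc (0 : ℝ) 1) ∧
        ∀ s ∈ Set.Icc (0 : ℝ) 1, E j (ζ s) = E j z0 + ∫ r in (0 : ℝ)..s, B j (ζ r) := by
  obtain ⟨W, hW, hWi, hNW, -, hWB⟩ := exists_weight (γ₀ : Measure Z) B hB hBi N hN hNi
  obtain ⟨γ, hγ, hγW, hext⟩ := exists_extremal hE hB hB0 z0 hW hWB γ₀ hγ₀ hWi
  have hint : ∀ φ v, IsTest E B φ v → Integrable v (γ : Measure Z) := fun φ v h =>
    (h.wApprox hE hWB).integrable (h.measurable hE hB) hγW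
  have H : IsExtremalSol E B z0 (γ : Measure Z) :=
    { continuous_coord := hE
      field_zero := hB0
      time_nonneg := hE0
      time_le_one := hE1
      time_start := hz0
      integrable := hint
      isSol := hγ
      dense := fun h hh ε hε => by
        obtain ⟨v, ⟨φ, hφ, hφ1⟩, hv⟩ := dense_of_annihilator (γ : Measure Z)
          {v | ∃ φ, IsTest E B φ v ∧ ∀ z, E 0 z = 1 → φ z = 0}
          ⟨_, IsTest.const 0, fun _ _ => rfl⟩
          (by
            rintro _ ⟨φ, h1, h2⟩ _ ⟨φ', h1', h2'⟩
            exact ⟨_, h1.add h1', fun z hz => by rw [h2 z hz, h2' z hz, add_zero]⟩)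
          (by
            rintro c _ ⟨φ, h1, h2⟩
            exact ⟨_, h1.const_mul c, fun z hz => by rw [h2 z hz, mul_zero]⟩)
          (by
            rintro _ ⟨φ, h1, h2⟩
            exact hint _ _ h1)
          (fun u hu hu1 hu2 => hext u hu hu1 fun φ v h1 h2 => hu2 v ⟨φ, h1, h2⟩) h hh ε hε
        exact ⟨φ, v, hφ, hφ1, hv⟩ }
  obtain ⟨ζ, hζc, hζ0, htime, hmap, hj⟩ := H.eq_map_curve hsep
  refine ⟨ζ, hζc, hζ0, htime, ?_, hj⟩
  rw [hmap, lintegral_map hW.measurable hζc.measurable] at hγW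
  exact (lintegral_mono fun s => hNW (ζ s)).trans_lt hγW

section Vague
open scoped CompactlySupported

namespace SP
variable {d : ℕ}

instance (μ : SP d) : IsFiniteMeasure μ.1 := ⟨μ.2.trans_lt ENNReal.one_lt_top⟩

lemma tendsto_iff {ι : Type*} {l : Filter ι} {u : ι → SP d} {μ : SP d} :
    Tendsto u l (𝓝 μ) ↔ ∀ g : Rd d → ℝ, Continuous g → HasCompactSupport g →
      Tendsto (fun i => ∫ x, g x ∂(u i).1) l (𝓝 (∫ x, g x ∂μ.1)) := by
  simp only [nhds_iInf, nhds_induced, tendsto_iInf, tendsto_comap_iff, Subtype.forall, and_imp]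
  rfl

lemma continuous_integral {g : Rd d → ℝ} (hg : Continuous g) (hgc : HasCompactSupport g) :
    Continuous fun μ : SP d => ∫ x, g x ∂μ.1 :=
  continuous_iff_continuousAt.2 fun _ => tendsto_iff.1 tendsto_id g hg hgc

lemma measureReal_univ_le_one (μ : SP d) : μ.1.real Set.univ ≤ 1 :=
  ENNReal.toReal_le_of_le_ofReal zero_le_one (by simpa using μ.2)

lemma abs_integral_le (μ : SP d) {f : Rd d → ℝ} {M : ℝ} (hM : 0 ≤ M) (h : ∀ x, |f x| ≤ M) :
    |∫ x, f x ∂μ.1| ≤ M := by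
  rw [← Real.norm_eq_abs]
  exact (norm_integral_le_of_norm_le_const (Eventually.of_forall h)).trans
    (mul_le_of_le_one_right hM μ.measureReal_univ_le_one)

lemma integrable_of_compactSupport (μ : SP d) {g : Rd d → ℝ} (hg : Continuous g)
    (hgc : HasCompactSupport g) : Integrable g μ.1 :=
  hg.integrable_of_hasCompactSupport hgc

instance : CompactSpace (SP d) := by
  refine ⟨isCompact_iff_ultrafilter_le_nhds.2 fun f _ => ?_⟩
  have L (g : C_c(Rd d, ℝ)) : ∃ x, Tendsto (fun μ : SP d => ∫ x, g x ∂μ.1) f (𝓝 x) := by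
    obtain ⟨M, hM⟩ := g.continuous.bounded_above_of_compact_support g.hasCompactSupport
    have hM0 : 0 ≤ M := (norm_nonneg _).trans (hM 0)
    obtain ⟨x, -, hx⟩ := isCompact_Icc.ultrafilter_le_nhds' (f.map fun μ : SP d => ∫ x, g x ∂μ.1)
      (s := Set.Icc (-M) M) (Ultrafilter.mem_map.2 (Eventually.of_forall fun μ =>
        abs_le.1 (μ.abs_integral_le hM0 hM)))
    exact ⟨x, hx⟩
  choose Λ hΛ using L
  have hi : ∀ (g : C_c(Rd d, ℝ)) (μ : SP d), Integrable g μ.1 := fun g μ =>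
    μ.integrable_of_compactSupport g.continuous g.hasCompactSupport
  let Λ' : C_c(Rd d, ℝ) →ₚ[ℝ] ℝ :=
    { toFun := Λ
      map_add' := fun g g' => by
        have h := (hΛ g).add (hΛ g')
        simp_rw [← integral_add (hi g _) (hi g' _)] at h
        exact tendsto_nhds_unique (hΛ (g + g')) h
      map_smul' := fun c g => by
        have h := (hΛ g).const_smul c
        simp_rw [← integral_smul] at h
        exact tendsto_nhds_unique (hΛ (c • g)) h
      monotone' := fun g g' h => le_of_tendsto_of_tendsto' (hΛ g) (hΛ g') fun μ =>
        integral_mono (hi g μ) (hi g' μ) h }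
  let ν := RealRMK.rieszMeasure Λ'
  have hν : ν Set.univ ≤ 1 := by
    rw [isOpen_univ.measure_eq_iSup_isCompact]
    refine iSup₂_le fun K _ => iSup_le fun hK => ?_
    obtain ⟨k, hk1, -, hkc, hk01⟩ := exists_continuous_one_zero_of_isCompact hK isClosed_empty
      (Set.disjoint_empty K)
    let kc : C_c(Rd d, ℝ) := ⟨k, hkc⟩
    refine (RealRMK.rieszMeasure_le_of_eq_one Λ' (f := kc) (fun x => (hk01 x).1) hK hk1).trans ?_
    rw [← ENNReal.ofReal_one]
    refine ENNReal.ofReal_le_ofReal (le_of_tendsto' (hΛ kc) fun μ => ?_)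
    refine (le_abs_self _).trans (μ.abs_integral_le zero_le_one fun x => ?_)
    change |k x| ≤ 1
    rw [abs_of_nonneg (hk01 x).1]
    exact (hk01 x).2
  refine ⟨⟨ν, hν⟩, trivial, ?_⟩
  change Tendsto id (f : Filter (SP d)) _
  refine tendsto_iff.2 fun g hg hgc => ?_
  let gc : C_c(Rd d, ℝ) := ⟨⟨g, hg⟩, hgc⟩
  have h := hΛ gc
  rwa [show Λ gc = ∫ x, gc x ∂ν from (RealRMK.integral_rieszMeasure Λ' gc).symm] at h

end SP

lemma Measure.ext_of_integral_contDiff_of_ac {d : ℕ} {μ ν ρ : Measure (Rd d)} [IsFiniteMeasure μ]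
    [IsFiniteMeasure ν] [SigmaFinite ρ] (h1 : μ ≪ ρ) (h2 : ν ≪ ρ)
    (h : ∀ φ : Rd d → ℝ, IsC2c φ → ∫ x, φ x ∂μ = ∫ x, φ x ∂ν) : μ = ν := by
  have := ae_eq_of_integral_contDiff_smul_eq
    (Measure.integrable_toReal_rnDeriv (μ := μ) (ν := ρ)).locallyIntegrable
    (Measure.integrable_toReal_rnDeriv (μ := ν) (ν := ρ)).locallyIntegrable fun φ hφ hφc => by
      simp_rw [smul_eq_mul, mul_comm (φ _), ← smul_eq_mul]
      rw [integral_rnDeriv_smul h1, integral_rnDeriv_smul h2]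
      exact h φ ⟨contDiff_infty.1 hφ 2, hφc⟩
  rw [← Measure.withDensity_rnDeriv_eq _ _ h1, ← Measure.withDensity_rnDeriv_eq _ _ h2]
  refine withDensity_congr_ae ?_
  filter_upwards [this, Measure.rnDeriv_lt_top μ ρ, Measure.rnDeriv_lt_top ν ρ]
    with x hx h3 h4
  rwa [ENNReal.toReal_eq_toReal_iff' h3.ne h4.ne] at hx

lemma Measure.ext_of_integral_contDiff {d : ℕ} {μ ν : Measure (Rd d)} [IsFiniteMeasure μ]
    [IsFiniteMeasure ν] (h : ∀ φ : Rd d → ℝ, IsC2c φ → ∫ x, φ x ∂μ = ∫ x, φ x ∂ν) : μ = ν :=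
  ext_of_integral_contDiff_of_ac (Measure.AbsolutelyContinuous.rfl.add_right ν)
    (add_comm ν μ ▸ Measure.AbsolutelyContinuous.rfl.add_right μ) h

namespace GFamily
variable {d : ℕ} {g : ℕ → Rd d → ℝ}

lemma continuous_integral (hg : GFamily d g) (k : ℕ) : Continuous fun μ : SP d => ∫ x, g k x ∂μ.1 :=
  SP.continuous_integral (hg.1 k).1.continuous (hg.1 k).2

lemma ext (hg : GFamily d g) {μ ν : SP d} (h : ∀ k, ∫ x, g k x ∂μ.1 = ∫ x, g k x ∂ν.1) :
    μ = ν := by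
  refine Subtype.ext (Measure.ext_of_integral_contDiff fun φ hφ => ?_)
  rw [← sub_eq_zero, ← abs_nonpos_iff]
  refine le_of_forall_pos_le_add fun ε hε => ?_
  obtain ⟨k, hk, -⟩ := hg.2.2 φ hφ (ε / 2) (half_pos hε)
  have key : ∀ ρ : SP d, |∫ x, g k x ∂ρ.1 - ∫ x, φ x ∂ρ.1| ≤ ε / 2 := fun ρ => by
    rw [← integral_sub (ρ.integrable_of_compactSupport (hg.1 k).1.continuous (hg.1 k).2)
      (ρ.integrable_of_compactSupport hφ.1.continuous hφ.2)]
    exact ρ.abs_integral_le (half_pos hε).le hk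
  have h1 := key μ
  have h2 := key ν
  rw [h k] at h1
  rw [abs_le] at h1 h2 ⊢
  constructor <;> linarith

lemma metrizableSpace (hg : GFamily d g) : TopologicalSpace.MetrizableSpace (SP d) := by
  have hc : Continuous fun (μ : SP d) (k : ℕ) => ∫ x, g k x ∂μ.1 :=
    continuous_pi hg.continuous_integral
  exact (hc.isClosedEmbedding fun μ ν h => hg.ext fun k => congrFun h k).isEmbedding.metrizableSpace

end GFamily

/-- A fixed smooth compactly supported function which equals one near the origin. -/
def bump (d : ℕ) : Rd d → ℝ := (⟨1, 2, one_pos, one_lt_two⟩ : ContDiffBump (0 : Rd d))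

/-- Rescaled cutoff functions exhausting the space. -/
def cutoff (d n : ℕ) (x : Rd d) : ℝ := bump d (((n : ℝ) + 1)⁻¹ • x)

section Cutoff
variable {d : ℕ}

lemma contDiff_bump {n : ℕ} : ContDiff ℝ n (bump d) :=
  ContDiffBump.contDiff (n := (n : ℕ∞)) _

lemma hasCompactSupport_bump : HasCompactSupport (bump d) :=
  ContDiffBump.hasCompactSupport _

lemma bump_nonneg (x : Rd d) : 0 ≤ bump d x := ContDiffBump.nonneg' _ _

lemma bump_le_one (x : Rd d) : bump d x ≤ 1 := ContDiffBump.le_one _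

lemma bump_eq_one {x : Rd d} (hx : ‖x‖ ≤ 1) : bump d x = 1 :=
  ContDiffBump.one_of_mem_closedBall _ (by simpa using hx)

lemma contDiff_cutoff (n : ℕ) {m : ℕ} : ContDiff ℝ m (cutoff d n) :=
  contDiff_bump.comp (contDiff_const_smul _)

lemma hasCompactSupport_cutoff (n : ℕ) : HasCompactSupport (cutoff d n) :=
  hasCompactSupport_bump.comp_homeomorph (Homeomorph.smulOfNeZero ((n : ℝ) + 1)⁻¹ (by positivity))

lemma isC2c_cutoff (n : ℕ) : IsC2c (cutoff d n) := ⟨contDiff_cutoff n, hasCompactSupport_cutoff n⟩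

lemma tendsto_cutoff (x : Rd d) : ∀ᶠ n in atTop, cutoff d n x = 1 := by
  obtain ⟨n₀, hn₀⟩ := exists_nat_ge ‖x‖
  filter_upwards [eventually_ge_atTop n₀] with n hn
  refine bump_eq_one ?_
  have : (n₀ : ℝ) ≤ n := by exact_mod_cast hn
  rw [norm_smul, norm_inv, Real.norm_of_nonneg (by positivity), inv_mul_le_one₀ (by positivity)]
  linarith

end Cutoff

lemma measurable_of_measurable_integral {S X : Type*} [MeasurableSpace S] [TopologicalSpace X]
    [MeasurableSpace X] [BorelSpace X] [HasOuterApproxClosed X] {Γ : S → Measure X}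
    [∀ s, IsFiniteMeasure (Γ s)]
    (h : ∀ f : X → ℝ, Continuous f → (∀ x, |f x| ≤ 1) → Measurable fun s => ∫ x, f x ∂Γ s) :
    Measurable Γ := by
  have key : ∀ f : X → NNReal, Continuous f → (∀ x, f x ≤ 1) → Measurable fun s =>
      ∫⁻ x, f x ∂Γ s := by
    intro f hf hf1
    have hb : ∀ x, |(f x : ℝ)| ≤ 1 := fun x => by
      rw [abs_of_nonneg NNReal.zero_le_coe]
      exact_mod_cast hf1 x
    have hc : Continuous fun x => (f x : ℝ) := NNReal.continuous_coe.comp hf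
    convert (h _ hc hb).ennreal_ofReal with s
    rw [ofReal_integral_eq_lintegral_ofReal
      ((integrable_const (1 : ℝ)).mono' hc.aestronglyMeasurable (Eventually.of_forall hb))
      (Eventually.of_forall fun x => NNReal.zero_le_coe)]
    simp
  refine Measurable.measure_of_isPiSystem ((BorelSpace.measurable_eq).trans
    borel_eq_generateFrom_isClosed) isPiSystem_isClosed (fun F hF => ?_) ?_
  · exact measurable_of_tendsto_metrizable
      (f := fun (n : ℕ) s => ∫⁻ x, hF.apprSeq n x ∂Γ s) (fun n => key _ (hF.apprSeq n).continuous
        fun x => HasOuterApproxClosed.apprSeq_apply_le_one hF n x)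
      (tendsto_pi_nhds.2 fun s => HasOuterApproxClosed.tendsto_lintegral_apprSeq hF (Γ s))
  · simpa using key (fun _ => 1) continuous_const fun _ => le_rfl

namespace SP
variable {d : ℕ}

lemma measurable_integral_of_bounded {f : Rd d → ℝ} (hf : Continuous f) {M : ℝ}
    (hM : ∀ x, |f x| ≤ M) : Measurable fun μ : SP d => ∫ x, f x ∂μ.1 := by
  refine measurable_of_tendsto_metrizable (f := fun (n : ℕ) (μ : SP d) => ∫ x, cutoff d n x * f
      x ∂μ.1)
    (fun n => ?_) (tendsto_pi_nhds.2 fun μ => ?_)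
  · exact (continuous_integral ((contDiff_cutoff n (m := 0)).continuous.mul hf)
      ((hasCompactSupport_cutoff n).mul_right)).measurable
  · refine tendsto_integral_of_dominated_convergence (fun _ => M)
      (fun n => ((contDiff_cutoff n (m := 0)).continuous.mul hf).aestronglyMeasurable)
      (integrable_const _) (fun n => Eventually.of_forall fun x => ?_) (Eventually.of_forall fun
          x => ?_)
    · rw [norm_mul]
      refine (mul_le_of_le_one_left (norm_nonneg _) ?_).trans (hM x)
      rw [cutoff, Real.norm_of_nonneg (bump_nonneg _)]
      exact bump_le_one _
    · refine tendsto_const_nhds.congr' ?_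
      filter_upwards [tendsto_cutoff x] with n hn
      rw [hn, one_mul]

lemma measurable_val : Measurable fun μ : SP d => μ.1 :=
  measurable_of_measurable_integral fun _ hf hM => measurable_integral_of_bounded hf hM

end SP

end Vague

section TimeDependent
variable {V X : Type*} [NormedAddCommGroup V] [NormedSpace ℝ V] [FiniteDimensional ℝ V]
  [MeasurableSpace X]

open unitInterval in
lemma integral_fderiv_time_dependent {γ : Measure (I × X)} [IsFiniteMeasure γ]
    {Γ : ℝ → Measure X} {e : X → V} (he : StronglyMeasurable e) {R : ℝ} (hR : ∀ x, ‖e x‖ ≤ R)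
    {H : I × X → V} (hH : Integrable H γ) {F : ℝ × V → ℝ} (hF : ContDiff ℝ 3 F)
    (hF1 : ∀ x, F (1, e x) = 0) (x₀ : X)
    (hCE : ∀ h : V → ℝ, ContDiff ℝ 2 h → ∀ θ ∈ Set.Icc (0 : ℝ) 1, ∫ x, h (e x) ∂Γ θ =
      h (e x₀) + ∫ z, (if (z.1 : ℝ) ≤ θ then fderiv ℝ h (e z.2) (H z) else 0) ∂γ)
    (hγ : ∀ p : ℝ × V → ℝ, Continuous p →
      ∫ z, p (z.1, e z.2) ∂γ = ∫ θ in Set.Ioc (0 : ℝ) 1, ∫ x, p (θ, e x) ∂Γ θ) :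
    ∫ z, fderiv ℝ F ((z.1 : ℝ), e z.2) (1, H z) ∂γ = - F (0, e x₀) := by
  have hF' : ContDiff ℝ 2 (fderiv ℝ F) := hF.fderiv_right (by norm_num)
  have hF'' : Continuous (fderiv ℝ (fderiv ℝ F)) :=
      (hF'.fderiv_right (m := 1) (by norm_num)).continuous
  set p : ℝ × V → ℝ := fun z => fderiv ℝ F z (1, 0) with hp
  have hpc : ContDiff ℝ 2 p := hF'.clm_apply contDiff_const
  set K : Set (ℝ × V) := Set.Icc 0 1 ×ˢ Metric.closedBall 0 R with hK
  have hKc : IsCompact K := isCompact_Icc.prod (isCompact_closedBall _ _)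
  have heK : ∀ θ ∈ Set.Icc (0 : ℝ) 1, ∀ x, (θ, e x) ∈ K := fun θ hθ x => ⟨hθ, by simpa using hR x⟩
  have hIK : ∀ z : I × X, ((z.1 : ℝ), e z.2) ∈ K := fun z => heK _ z.1.2 _
  obtain ⟨C₂, hC₂⟩ := hKc.exists_bound_of_continuousOn
    (f := fun q => ‖fderiv ℝ (fderiv ℝ F) q‖) ((hF'.fderiv_right (m := 1)
        (by norm_num)).continuous.norm).continuousOn
  replace hC₂ : ∀ q ∈ K, ‖fderiv ℝ (fderiv ℝ F) q‖ ≤ C₂ := fun q hq => (le_abs_self _).trans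
      (hC₂ q hq)
  obtain ⟨C₁, hC₁⟩ := hKc.exists_bound_of_continuousOn
    (f := fun q => ‖fderiv ℝ F q‖) hF'.continuous.norm.continuousOn
  replace hC₁ : ∀ q ∈ K, ‖fderiv ℝ F q‖ ≤ C₁ := fun q hq => (le_abs_self _).trans (hC₁ q hq)
  -- the mixed second derivative
  set W : ℝ × (I × X) → ℝ := fun q => fderiv ℝ (fderiv ℝ F) (q.1, e q.2.2) (1, 0) (0, H q.2) with hW
  have hpd : ∀ θ y w, fderiv ℝ (fun y => p (θ, y)) y w = fderiv ℝ (fderiv ℝ F) (θ, y) (1, 0) (0,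
      w) := by
    intro θ y w
    have h1 : HasFDerivAt (fun y => p (θ, y))
        ((fderiv ℝ p (θ, y)).comp (ContinuousLinearMap.inr ℝ ℝ V)) y :=
      (hpc.differentiable (by norm_num) _).hasFDerivAt.comp y (hasFDerivAt_prodMk_right θ y)
    rw [h1.fderiv]
    have h2 : HasFDerivAt p ((fderiv ℝ (fderiv ℝ F) (θ, y)).flip (1, 0)) (θ, y) := by
      simpa using ((hF'.differentiable (by norm_num) (θ, y)).hasFDerivAt).clm_apply
        (hasFDerivAt_const ((1 : ℝ), (0 : V)) (θ, y))
    rw [h2.fderiv]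
    exact ((hF.of_le (by norm_num) : ContDiff ℝ 2 F).contDiffAt.isSymmSndFDerivAt (by simp)) _ _
  have hsub : ∀ s y w, ContDiff ℝ 1 fun θ : ℝ => fderiv ℝ F (θ, y) (s, w) := fun s y w =>
    ((hF'.of_le one_le_two).comp (contDiff_id.prodMk contDiff_const)).clm_apply contDiff_const
  have hder : ∀ y w θ, HasDerivAt (fun θ : ℝ => fderiv ℝ F (θ, y) (0, w))
      (fderiv ℝ (fderiv ℝ F) (θ, y) (1, 0) (0, w)) θ := by
    intro y w θ
    have h1 : HasDerivAt (fun θ : ℝ => ((θ, y) : ℝ × V)) (1, 0) θ :=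
      (hasDerivAt_id θ).prodMk (hasDerivAt_const θ y)
    have h2 := (hF'.differentiable (by norm_num) (θ, y)).hasFDerivAt.comp_hasDerivAt θ h1
    simpa using h2.clm_apply (hasDerivAt_const θ ((0 : ℝ), w))
  have hder0 : ∀ y θ, HasDerivAt (fun θ : ℝ => F (θ, y)) (p (θ, y)) θ := by
    intro y θ
    have h1 : HasDerivAt (fun θ : ℝ => ((θ, y) : ℝ × V)) (1, 0) θ :=
      (hasDerivAt_id θ).prodMk (hasDerivAt_const θ y)
    exact (hF.differentiable (by norm_num) (θ, y)).hasFDerivAt.comp_hasDerivAt θ h1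
  -- measurability
  set lam : Measure ℝ := volume.restrict (Set.Ioc 0 1) with hlam
  have hem : StronglyMeasurable fun q : ℝ × (I × X) => (q.1, e q.2.2) :=
    (measurable_fst.stronglyMeasurable).prodMk
      (he.comp_measurable (measurable_snd.comp measurable_snd))
  have hHm : AEStronglyMeasurable (fun q : ℝ × (I × X) => H q.2) (lam.prod γ) :=
    hH.aestronglyMeasurable.comp_snd
  have hWm : AEStronglyMeasurable W (lam.prod γ) := by
    have hc : Continuous fun r : (ℝ × V) × V => fderiv ℝ (fderiv ℝ F) r.1 (1, 0) (0, r.2) :=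
      ((hF''.comp continuous_fst).clm_apply continuous_const).clm_apply
        (continuous_const.prodMk continuous_snd)
    exact hc.comp_aestronglyMeasurable (hem.aestronglyMeasurable.prodMk hHm)
  set S : Set (ℝ × (I × X)) := {q | (q.2.1 : ℝ) ≤ q.1} with hS
  have hSm : MeasurableSet S :=
    measurableSet_le (measurable_subtype_coe.comp (measurable_fst.comp measurable_snd))
        measurable_fst
  have hWb : ∀ θ ∈ Set.Icc (0 : ℝ) 1, ∀ z, ‖W (θ, z)‖ ≤ C₂ * ‖H z‖ := by
    intro θ hθ z
    refine (ContinuousLinearMap.le_opNorm _ _).trans ?_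
    refine mul_le_mul ((ContinuousLinearMap.le_opNorm _ _).trans ?_) (by simp) (norm_nonneg _)
      ((norm_nonneg (fderiv ℝ (fderiv ℝ F) (θ, e z.2))).trans (hC₂ _ (heK θ hθ z.2)))
    simpa using hC₂ _ (heK θ hθ z.2)
  have hWi : Integrable (S.indicator W) (lam.prod γ) := by
    refine Integrable.indicator ?_ hSm
    refine Integrable.mono' ((hH.norm.const_mul C₂).comp_snd lam) hWm ?_
    have : ∀ᵐ θ ∂lam, θ ∈ Set.Ioc (0 : ℝ) 1 := ae_restrict_mem measurableSet_Ioc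
    have h2 : ∀ᵐ q ∂lam.prod γ, q.1 ∈ Set.Ioc (0 : ℝ) 1 := Measure.quasiMeasurePreserving_fst.ae
        this
    filter_upwards [h2] with q hq
    exact hWb q.1 ⟨hq.1.le, hq.2⟩ q.2
  -- Fubini
  have hswap := integral_integral_swap (f := fun θ z => S.indicator W (θ, z)) hWi
  have hinner : ∀ z : I × X, ∫ θ, S.indicator W (θ, z) ∂lam =
      fderiv ℝ F (1, e z.2) (0, H z) - fderiv ℝ F (z.1, e z.2) (0, H z) := by
    intro z
    have hs := z.1.2
    have h1 : (∫ θ in (z.1 : ℝ)..1, W (θ, z)) =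
        fderiv ℝ F (1, e z.2) (0, H z) - fderiv ℝ F (z.1, e z.2) (0, H z) := by
      refine intervalIntegral.integral_eq_sub_of_hasDerivAt (fun θ _ => hder (e z.2) (H z) θ) ?_
      refine Continuous.intervalIntegrable ?_ _ _
      exact ((hF''.comp (by fun_prop)).clm_apply continuous_const).clm_apply continuous_const
    rw [← h1, intervalIntegral.integral_of_le hs.2]
    have h2 : (fun θ => S.indicator W (θ, z)) = (Set.Ici (z.1 : ℝ)).indicator fun θ =>
        W (θ, z) := by
      ext θ
      simp [Set.indicator_apply, hS]
    rw [h2, integral_indicator measurableSet_Ici, hlam, Measure.restrict_restrict measurableSet_Ici]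
    rw [← integral_Icc_eq_integral_Ioc]
    refine setIntegral_congr_set ?_
    have : (Set.Icc (z.1 : ℝ) 1) = Set.Ici (z.1 : ℝ) ∩ Set.Icc 0 1 := by
      ext r
      have := hs.1
      simp only [Set.mem_Icc, Set.mem_inter_iff, Set.mem_Ici]
      constructor
      · rintro ⟨h, h'⟩
        exact ⟨h, this.trans h, h'⟩
      · rintro ⟨h, -, h'⟩
        exact ⟨h, h'⟩
    rw [this]
    exact (ae_eq_refl _).inter Ioc_ae_eq_Icc
  -- integrability of the remaining terms
  have hgi : ∀ (c : I × X → ℝ), StronglyMeasurable c → (∀ z, c z ∈ Set.Icc (0 : ℝ) 1) →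
      Integrable (fun z => fderiv ℝ F (c z, e z.2) (0, H z)) γ := by
    intro c hcm hc
    have hc' : Continuous fun r : (ℝ × V) × V => fderiv ℝ F r.1 (0, r.2) :=
      (hF'.continuous.comp continuous_fst).clm_apply (continuous_const.prodMk continuous_snd)
    refine Integrable.mono' (hH.norm.const_mul C₁) (hc'.comp_aestronglyMeasurable
      ((hcm.prodMk (he.comp_measurable measurable_snd)).aestronglyMeasurable.prodMk
        hH.aestronglyMeasurable)) (Eventually.of_forall fun z => ?_)
    refine (ContinuousLinearMap.le_opNorm _ _).trans ?_
    exact mul_le_mul (hC₁ _ (heK _ (hc z) _)) (by simp) (norm_nonneg _)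
      ((norm_nonneg _).trans (hC₁ _ (heK _ (hc z) z.2)))
  have hcoe : StronglyMeasurable fun z : I × X => (z.1 : ℝ) :=
    (measurable_subtype_coe.comp measurable_fst).stronglyMeasurable
  have hi1 := hgi (fun _ => 1) stronglyMeasurable_const fun _ => by simp
  have his := hgi (fun z => z.1) hcoe fun z => z.1.2
  have hip : Integrable (fun z : I × X => p (z.1, e z.2)) γ := by
    obtain ⟨C, hC⟩ := hKc.exists_bound_of_continuousOn hpc.continuous.continuousOn
    refine (integrable_const C).mono' (hpc.continuous.comp_stronglyMeasurable
      (hcoe.prodMk (he.comp_measurable measurable_snd))).aestronglyMeasurable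
      (Eventually.of_forall fun z => hC _ (hIK z))
  have hend : ∫ z, fderiv ℝ F (1, e z.2) (0, H z) ∂γ = 0 := by
    have h := hCE (fun y => F (1, y)) ((hF.of_le (by norm_num)).comp (by fun_prop)) 1 (by simp)
    simp only [hF1, integral_zero, zero_add] at h
    refine Eq.trans ?_ h.symm
    refine integral_congr_ae (Eventually.of_forall fun z => ?_)
    have h1 : HasFDerivAt (fun y => F (1, y))
        ((fderiv ℝ F (1, e z.2)).comp (ContinuousLinearMap.inr ℝ ℝ V)) (e z.2) :=
      (hF.differentiable (by norm_num) _).hasFDerivAt.comp _ (hasFDerivAt_prodMk_right _ _)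
    simp [h1.fderiv, z.1.2.2]
  have hp0 : ∫ θ, p (θ, e x₀) ∂lam = - F (0, e x₀) := by
    have := intervalIntegral.integral_eq_sub_of_hasDerivAt (a := 0) (b := 1)
      (fun θ _ => hder0 (e x₀) θ) ((hpc.continuous.comp (by fun_prop)).intervalIntegrable _ _)
    rw [intervalIntegral.integral_of_le zero_le_one, hF1, zero_sub] at this
    exact this
  have hA : ∫ z, p (z.1, e z.2) ∂γ =
      - F (0, e x₀) - ∫ z, fderiv ℝ F (z.1, e z.2) (0, H z) ∂γ := by
    rw [hγ p hpc.continuous]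
    have h1 : ∀ θ ∈ Set.Ioc (0 : ℝ) 1, ∫ x, p (θ, e x) ∂Γ θ =
        p (θ, e x₀) + ∫ z, S.indicator W (θ, z) ∂γ := by
      intro θ hθ
      rw [hCE (fun y => p (θ, y)) (hpc.comp (by fun_prop)) θ ⟨hθ.1.le, hθ.2⟩]
      simp only [hpd]
      rfl
    rw [setIntegral_congr_fun measurableSet_Ioc h1, integral_add _ hWi.integral_prod_left, hp0,
        hswap]
    · simp only [hinner]
      rw [integral_sub hi1 his, hend, zero_sub, sub_eq_add_neg]
    · exact ((hpc.continuous.comp (by fun_prop)).integrableOn_Icc (a := 0) (b := 1)).mono_set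
        Set.Ioc_subset_Icc_self
  have hsplit : ∀ z : I × X, fderiv ℝ F ((z.1 : ℝ), e z.2) (1, H z) =
      p (z.1, e z.2) + fderiv ℝ F (z.1, e z.2) (0, H z) := fun z => by
    rw [hp, ← map_add]
    simp
  simp only [hsplit]
  rw [integral_add hip his, hA, sub_add_cancel]

end TimeDependent

section PartialDerivatives
variable {n : ℕ} {f : (Fin n → ℝ) → ℝ}

lemma contDiff_pd {m k : WithTop ℕ∞} (hf : ContDiff ℝ k f) (hmk : m + 1 ≤ k) (i : Fin n) :
    ContDiff ℝ m (pd f i) :=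
  (hf.fderiv_right hmk).clm_apply contDiff_const

lemma contDiff_pd2 {m k : WithTop ℕ∞} (hf : ContDiff ℝ k f) (hmk : m + 1 + 1 ≤ k) (i j : Fin n) :
    ContDiff ℝ m (pd2 f i j) :=
  contDiff_pd (contDiff_pd hf hmk j) le_rfl i

lemma hasCompactSupport_pd (hf : HasCompactSupport f) (i : Fin n) : HasCompactSupport (pd f i) :=
  hf.fderiv_apply ℝ _

lemma hasCompactSupport_pd2 (hf : HasCompactSupport f) (i j : Fin n) :
    HasCompactSupport (pd2 f i j) :=
  hasCompactSupport_pd (hasCompactSupport_pd hf j) i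

lemma fderiv_apply_eq_sum_pd (x v : Fin n → ℝ) : fderiv ℝ f x v = ∑ k, pd f k x * v k := by
  conv_lhs => rw [← Finset.univ_sum_single v]
  simp only [map_sum]
  refine Finset.sum_congr rfl fun k _ => ?_
  rw [← mul_one (v k), ← smul_eq_mul (v k) 1, Pi.single_smul, map_smul, smul_eq_mul, smul_eq_mul,
    mul_one, mul_comm, pd]

lemma Continuous.exists_abs_le_of_hasCompactSupport {X : Type*} [TopologicalSpace X] {f : X → ℝ}
    (hf : Continuous f) (hc : HasCompactSupport f) : ∃ M, ∀ x, |f x| ≤ M :=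
  hf.bounded_above_of_compact_support hc

lemma IsC2c.isC2b (hf : IsC2c f) : IsC2b f := by
  obtain ⟨M₀, hM₀⟩ := hf.1.continuous.exists_abs_le_of_hasCompactSupport hf.2
  choose M₁ hM₁ using fun i => (contDiff_pd (m := 0) hf.1 (by norm_num)
      i).continuous.exists_abs_le_of_hasCompactSupport
    (hasCompactSupport_pd hf.2 i)
  choose M₂ hM₂ using fun i j => (contDiff_pd2 (m := 0) hf.1 (by norm_num) i
      j).continuous.exists_abs_le_of_hasCompactSupport
    (hasCompactSupport_pd2 hf.2 i j)
  have h0 : 0 ≤ |M₀| := abs_nonneg _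
  have h1 : 0 ≤ ∑ i, |M₁ i| := Finset.sum_nonneg fun _ _ => abs_nonneg _
  have h2 : 0 ≤ ∑ i, ∑ j, |M₂ i j| :=
    Finset.sum_nonneg fun _ _ => Finset.sum_nonneg fun _ _ => abs_nonneg _
  refine ⟨hf.1, |M₀| + ∑ i, |M₁ i| + ∑ i, ∑ j, |M₂ i j|, fun x => ⟨?_, fun i => ?_, fun i j => ?_⟩⟩
  · linarith [hM₀ x, le_abs_self M₀]
  · linarith [hM₁ i x, le_abs_self (M₁ i),
      Finset.single_le_sum (f := fun i => |M₁ i|) (fun _ _ => abs_nonneg _) (Finset.mem_univ i)]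
  · linarith [hM₂ i j x, le_abs_self (M₂ i j),
      Finset.single_le_sum (f := fun j => |M₂ i j|) (fun _ _ => abs_nonneg _) (Finset.mem_univ j),
      Finset.single_le_sum (f := fun i => ∑ j, |M₂ i j|)
        (fun _ _ => Finset.sum_nonneg fun _ _ => abs_nonneg _) (Finset.mem_univ i)]

end PartialDerivatives

section Operator
variable {d : ℕ} {a : ℝ → SP d → Rd d → Fin d → Fin d → ℝ} {b : ℝ → SP d → Rd d → Fin d → ℝ}

/-- The total size of the coefficients. -/
def coeffNorm (a : ℝ → SP d → Rd d → Fin d → Fin d → ℝ) (b : ℝ → SP d → Rd d → Fin d → ℝ)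
    (t : ℝ) (μ : SP d) (x : Rd d) : ℝ :=
  (∑ i, |b t μ x i|) + ∑ i, ∑ j, |a t μ x i j|

/-- The `L¹(μ)` size of the coefficients. -/
def coeffInt (a : ℝ → SP d → Rd d → Fin d → Fin d → ℝ) (b : ℝ → SP d → Rd d → Fin d → ℝ)
    (t : ℝ) (μ : SP d) : ENNReal :=
  ∫⁻ x, ENNReal.ofReal (coeffNorm a b t μ x) ∂μ.1

lemma coeffNorm_nonneg (t : ℝ) (μ : SP d) (x : Rd d) : 0 ≤ coeffNorm a b t μ x :=
  add_nonneg (Finset.sum_nonneg fun _ _ => abs_nonneg _)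
    (Finset.sum_nonneg fun _ _ => Finset.sum_nonneg fun _ _ => abs_nonneg _)

lemma abs_Lop_le {φ : Rd d → ℝ} {C : ℝ} {x : Rd d} (h1 : ∀ i, |pd φ i x| ≤ C)
    (h2 : ∀ i j, |pd2 φ i j x| ≤ C) (t : ℝ) (μ : SP d) :
    |Lop a b t μ φ x| ≤ C * coeffNorm a b t μ x := by
  rw [coeffNorm, mul_add, add_comm, Finset.mul_sum, Finset.mul_sum, Lop, add_comm]
  refine (abs_add_le _ _).trans ?_
  rw [add_comm]
  refine add_le_add ((Finset.abs_sum_le_sum_abs _ _).trans (Finset.sum_le_sum fun i _ => ?_))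
    ((Finset.abs_sum_le_sum_abs _ _).trans (Finset.sum_le_sum fun i _ => ?_))
  · rw [Finset.mul_sum]
    refine (Finset.abs_sum_le_sum_abs _ _).trans (Finset.sum_le_sum fun j _ => ?_)
    rw [abs_mul, mul_comm]
    exact mul_le_mul_of_nonneg_right (h2 i j) (abs_nonneg _)
  · rw [abs_mul, mul_comm]
    exact mul_le_mul_of_nonneg_right (h1 i) (abs_nonneg _)

lemma GoodCoeffs.measurable_coeffNorm (hab : GoodCoeffs d a b) :
    Measurable fun p : (ℝ × SP d) × Rd d => coeffNorm a b p.1.1 p.1.2 p.2 := by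
  have ha : ∀ i j, Measurable fun p : (ℝ × SP d) × Rd d => a p.1.1 p.1.2 p.2 i j := fun i j =>
    (hab.1 i j).comp MeasurableEquiv.prodAssoc.measurable
  have hb : ∀ i, Measurable fun p : (ℝ × SP d) × Rd d => b p.1.1 p.1.2 p.2 i := fun i =>
    (hab.2.1 i).comp MeasurableEquiv.prodAssoc.measurable
  exact (Finset.measurable_fun_sum _ fun i _ => (hb i).abs).add
    (Finset.measurable_fun_sum _ fun i _ => Finset.measurable_fun_sum _ fun j _ => (ha i j).abs)

lemma GoodCoeffs.measurable_Lop (hab : GoodCoeffs d a b) {φ : Rd d → ℝ} (hφ : ContDiff ℝ 2 φ) :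
    Measurable fun p : (ℝ × SP d) × Rd d => Lop a b p.1.1 p.1.2 φ p.2 := by
  have ha : ∀ i j, Measurable fun p : (ℝ × SP d) × Rd d => a p.1.1 p.1.2 p.2 i j := fun i j =>
    (hab.1 i j).comp MeasurableEquiv.prodAssoc.measurable
  have hb : ∀ i, Measurable fun p : (ℝ × SP d) × Rd d => b p.1.1 p.1.2 p.2 i := fun i =>
    (hab.2.1 i).comp MeasurableEquiv.prodAssoc.measurable
  have h1 : ∀ i, Measurable (pd φ i) := fun i =>
    (contDiff_pd (m := 0) hφ (by norm_num) i).continuous.measurable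
  have h2 : ∀ i j, Measurable (pd2 φ i j) := fun i j =>
    (contDiff_pd2 (m := 0) hφ (by norm_num) i j).continuous.measurable
  exact (Finset.measurable_fun_sum _ fun i _ => Finset.measurable_fun_sum _ fun j _ =>
    (ha i j).mul ((h2 i j).comp measurable_snd)).add
    (Finset.measurable_fun_sum _ fun i _ => (hb i).mul ((h1 i).comp measurable_snd))

lemma measurable_slice {β : Type*} [MeasurableSpace β] {f : (ℝ × SP d) × Rd d → β}
    (hf : Measurable f) (t : ℝ) (μ : SP d) : Measurable fun x => f ((t, μ), x) :=
  hf.comp measurable_prodMk_left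

section Metrizable
variable [HasOuterApproxClosed (SP d)]

/-- The tautological kernel from time-measure pairs to the state space. -/
def SP.kernel (d : ℕ) : ProbabilityTheory.Kernel (ℝ × SP d) (Rd d) :=
  ⟨fun p => p.2.1, SP.measurable_val.comp measurable_snd⟩

instance : ProbabilityTheory.IsFiniteKernel (SP.kernel d) :=
  ⟨⟨1, ENNReal.one_lt_top, fun p => p.2.2⟩⟩

lemma GoodCoeffs.measurable_coeffInt (hab : GoodCoeffs d a b) :
    Measurable fun p : ℝ × SP d => coeffInt a b p.1 p.2 :=
  Measurable.lintegral_kernel_prod_right' (κ := SP.kernel d) hab.measurable_coeffNorm.ennreal_ofReal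

lemma GoodCoeffs.measurable_integral_Lop (hab : GoodCoeffs d a b) {φ : Rd d → ℝ}
    (hφ : ContDiff ℝ 2 φ) :
    Measurable fun p : ℝ × SP d => ∫ x, Lop a b p.1 p.2 φ x ∂p.2.1 :=
  (StronglyMeasurable.integral_kernel_prod_right' (κ := SP.kernel d)
    (hab.measurable_Lop hφ).stronglyMeasurable).measurable

end Metrizable

lemma GoodCoeffs.integrable_coeffNorm (hab : GoodCoeffs d a b) {t : ℝ} {μ : SP d}
    (h : coeffInt a b t μ < ⊤) : Integrable (coeffNorm a b t μ) μ.1 := by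
  refine ⟨(measurable_slice hab.measurable_coeffNorm t μ).aestronglyMeasurable, ?_⟩
  rwa [hasFiniteIntegral_iff_ofReal (Eventually.of_forall (coeffNorm_nonneg t μ))]

lemma enorm_integral_Lop_le {φ : Rd d → ℝ} {C : ℝ} (h1 : ∀ i x, |pd φ i x| ≤ C)
    (h2 : ∀ i j x, |pd2 φ i j x| ≤ C) (hC : 0 ≤ C) (t : ℝ) (μ : SP d) :
    ‖∫ x, Lop a b t μ φ x ∂μ.1‖ₑ ≤ ENNReal.ofReal C * coeffInt a b t μ := by
  refine (enorm_integral_le_lintegral_enorm _).trans ?_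
  rw [coeffInt, ← lintegral_const_mul' _ _ ENNReal.ofReal_ne_top]
  refine lintegral_mono fun x => ?_
  rw [← ENNReal.ofReal_mul hC, Real.enorm_eq_ofReal_abs]
  exact ENNReal.ofReal_le_ofReal (abs_Lop_le (fun i => h1 i x) (fun i j => h2 i j x) t μ)

end Operator

open unitInterval in
lemma integral_unitInterval_coe {E : Type*} [NormedAddCommGroup E] [NormedSpace ℝ E] (f : ℝ → E) :
    ∫ s : I, f s = ∫ s in Set.Ioc (0 : ℝ) 1, f s := by
  rw [← integral_Icc_eq_integral_Ioc, integral_subtype measurableSet_Icc]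

open unitInterval in
lemma lintegral_unitInterval_coe (f : ℝ → ENNReal) :
    ∫⁻ s : I, f s = ∫⁻ s in Set.Ioc (0 : ℝ) 1, f s := by
  rw [restrict_Ioc_eq_restrict_Icc]
  exact lintegral_subtype_comap measurableSet_Icc f

lemma lintegral_Ioc_comp_mul_left {T : ℝ} (hT : 0 < T) (f : ℝ → ENNReal) :
    ENNReal.ofReal T * ∫⁻ s in Set.Ioc (0 : ℝ) 1, f (T * s) = ∫⁻ t in Set.Ioc (0 : ℝ) T, f t := by
  have he : MeasurableEmbedding (T * · : ℝ → ℝ) :=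
      (Homeomorph.mulLeft₀ T hT.ne').measurableEmbedding
  have hpre : (T * · : ℝ → ℝ) ⁻¹' Set.Ioc 0 T = Set.Ioc 0 1 := by
    ext s
    simp [hT, div_self hT.ne']
  conv_rhs => rw [← Real.smul_map_volume_mul_left hT.ne', abs_of_pos hT, Measure.restrict_smul,
    lintegral_smul_measure, he.restrict_map, he.lintegral_map, hpre]
  rw [smul_eq_mul]

section
variable {d : ℕ} {T : ℝ} {a : ℝ → SP d → Rd d → Fin d → Fin d → ℝ}
  {b : ℝ → SP d → Rd d → Fin d → ℝ} {g : ℕ → Rd d → ℝ} {Γ : ℝ → Measure (SP d)}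

lemma GFamily.exists_norm_le (hg : GFamily d g) (n : ℕ) :
    ∃ R : ℝ, ∀ μ : SP d, ‖fun k : Fin n => ∫ x, g k x ∂μ.1‖ ≤ R := by
  choose M hM using fun k =>
    (hg.1 k).1.continuous.exists_abs_le_of_hasCompactSupport (hg.1 k).2
  refine ⟨∑ k : Fin n, |M k|, fun μ => (pi_norm_le_iff_of_nonneg
    (Finset.sum_nonneg fun _ _ => abs_nonneg _)).2 fun k => ?_⟩
  refine (μ.abs_integral_le (abs_nonneg _) fun x => (hM k x).trans (le_abs_self _)).trans ?_
  exact Finset.single_le_sum (f := fun k : Fin n => |M k|) (fun _ _ => abs_nonneg _)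
    (Finset.mem_univ k)

lemma bL_eq_fderiv {n : ℕ} (f : (Fin n → ℝ) → ℝ) (t : ℝ) (μ : SP d) :
    bL a b g f t μ = fderiv ℝ f (fun k : Fin n => ∫ x, g k x ∂μ.1)
      (fun k : Fin n => ∫ x, Lop a b t μ (g k) x ∂μ.1) := by
  rw [fderiv_apply_eq_sum_pd, bL]

lemma IsSPCESolution.eq_of_contDiff (hΓ : IsSPCESolution d T a b g Γ) (hg : GFamily d g) {n : ℕ}
    {f : (Fin n → ℝ) → ℝ} (hf : ContDiff ℝ 2 f) {t : ℝ} (ht : t ∈ Set.Icc 0 T) :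
    ∫ μ, Fof g f μ ∂(Γ t) - ∫ μ, Fof g f μ ∂(Γ 0) =
      ∫ s in (0 : ℝ)..t, ∫ μ, bL a b g f s μ ∂(Γ s) := by
  obtain ⟨R, hR⟩ := hg.exists_norm_le n
  obtain ⟨N, hN⟩ := exists_nat_ge R
  have heq : ∀ μ : SP d, (fun x => cutoff n N x * f x) =ᶠ[𝓝 fun k : Fin n => ∫ x, g k x ∂μ.1]
      f := by
    intro μ
    have hlt : ‖fun k : Fin n => ∫ x, g k x ∂μ.1‖ < N + 1 := by linarith [hR μ]
    filter_upwards [(isOpen_lt continuous_norm continuous_const).mem_nhds hlt] with x hx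
    have hx : ‖x‖ < N + 1 := hx
    rw [cutoff, bump_eq_one, one_mul]
    rw [norm_smul, norm_inv, Real.norm_of_nonneg (by positivity), inv_mul_le_one₀ (by positivity)]
    exact hx.le
  have key := hΓ.2.2.2 n (fun x => cutoff n N x * f x) (IsC2c.isC2b
    ⟨(contDiff_cutoff N (m := 2)).mul hf, (hasCompactSupport_cutoff N).mul_right⟩) t ht
  have h1 : ∀ μ : SP d, Fof g (fun x => cutoff n N x * f x) μ = Fof g f μ := fun μ =>
      (heq μ).self_of_nhds
  have h2 : ∀ s (μ : SP d), bL a b g (fun x => cutoff n N x * f x) s μ = bL a b g f s μ :=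
      fun s μ => by
    rw [bL_eq_fderiv, bL_eq_fderiv, (heq μ).fderiv_eq]
  simpa only [h1, h2] using key

/-- The coordinates of the rescaled space-time state. -/
def stateCoord (g : ℕ → Rd d → ℝ) : ℕ → unitInterval × SP d → ℝ
  | 0, z => z.1
  | k + 1, z => ∫ x, g k x ∂z.2.1

/-- The velocity of the coordinates of the rescaled space-time state. -/
def stateVel (T : ℝ) (a : ℝ → SP d → Rd d → Fin d → Fin d → ℝ)
    (b : ℝ → SP d → Rd d → Fin d → ℝ) (g : ℕ → Rd d → ℝ) : ℕ → unitInterval × SP d → ℝ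
  | 0, _ => 1
  | k + 1, z => T * ∫ x, Lop a b (T * z.1) z.2 (g k) x ∂z.2.1

lemma mul_unitInterval_mem (hT : 0 < T) (s : unitInterval) : T * (s : ℝ) ∈ Set.Icc 0 T :=
  ⟨mul_nonneg hT.le s.2.1, mul_le_of_le_one_right hT.le s.2.2⟩

variable [HasOuterApproxClosed (SP d)]

lemma GoodCoeffs.measurable_stateVel (hab : GoodCoeffs d a b) (hg : GFamily d g) (k : ℕ) :
    Measurable (stateVel T a b g k) := by
  cases k with
  | zero => exact measurable_const
  | succ k =>
    refine Measurable.const_mul ((hab.measurable_integral_Lop (hg.1 k).1).comp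
      (f := fun z : unitInterval × SP d => (T * (z.1 : ℝ), z.2)) ?_) T
    exact ((measurable_subtype_coe.comp measurable_fst).const_mul T).prodMk measurable_snd

lemma GoodCoeffs.measurable_coeffInt_state (hab : GoodCoeffs d a b) :
    Measurable fun z : unitInterval × SP d => coeffInt a b (T * z.1) z.2 :=
  hab.measurable_coeffInt.comp (f := fun z : unitInterval × SP d => (T * (z.1 : ℝ), z.2))
    (((measurable_subtype_coe.comp measurable_fst).const_mul T).prodMk measurable_snd)

lemma IsSPCESolution.exists_kernel (hΓ : IsSPCESolution d T a b g Γ) (hT : 0 < T) :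
    ∃ κ : ProbabilityTheory.Kernel unitInterval (SP d), ProbabilityTheory.IsMarkovKernel κ ∧
      ∀ s, κ s = Γ (T * s) := by
  have hp : ∀ s : unitInterval, IsProbabilityMeasure (Γ (T * s)) := fun s =>
    hΓ.1 _ (mul_unitInterval_mem hT s)
  refine ⟨⟨fun s => Γ (T * s), measurable_of_measurable_integral fun f hf hb => ?_⟩,
    ⟨fun s => hp s⟩, fun s => rfl⟩
  exact ((hΓ.2.1 f hf ⟨1, hb⟩).comp_continuous (by fun_prop)
    (mul_unitInterval_mem hT)).measurable

lemma IsSPCESolution.exists_isSol (hΓ : IsSPCESolution d T a b g Γ) (hT : 0 < T)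
    (hab : GoodCoeffs d a b) (hg : GFamily d g) {μ₀ : SP d} (h0 : Γ 0 = Measure.dirac μ₀) :
    ∃ γ : ProbabilityMeasure (unitInterval × SP d),
      IsSol (stateCoord g) (stateVel T a b g) (0, μ₀) γ ∧
      (∀ k, Integrable (stateVel T a b g k) (γ : Measure (unitInterval × SP d))) ∧
      ∫⁻ z, coeffInt a b (T * z.1) z.2 ∂(γ : Measure (unitInterval × SP d)) < ⊤ := by
  obtain ⟨κ, hκ, hκΓ⟩ := hΓ.exists_kernel hT
  let γ : Measure (unitInterval × SP d) := (volume : Measure unitInterval).compProd κ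
  have hN : ∫⁻ z, coeffInt a b (T * z.1) z.2 ∂γ < ⊤ := by
    rw [Measure.lintegral_compProd hab.measurable_coeffInt_state]
    simp only [hκΓ]
    rw [lintegral_unitInterval_coe fun s => ∫⁻ μ, coeffInt a b (T * s) μ ∂Γ (T * s)]
    refine ENNReal.lt_top_of_mul_ne_top_right (a := ENNReal.ofReal T) ?_ (by simpa using hT)
    rw [lintegral_Ioc_comp_mul_left hT fun t => ∫⁻ μ, coeffInt a b t μ ∂Γ t]
    exact hΓ.2.2.1.ne
  have hvel : ∀ k, Integrable (stateVel T a b g k) γ := by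
    intro k
    refine ⟨(hab.measurable_stateVel hg k).aestronglyMeasurable, ?_⟩
    cases k with
    | zero => exact (integrable_const (1 : ℝ)).2
    | succ k =>
      obtain ⟨-, C, hC⟩ := (hg.1 k).isC2b
      have hC0 : 0 ≤ C := (abs_nonneg _).trans (hC 0).1
      refine lt_of_le_of_lt (lintegral_mono fun z => ?_)
        ((lintegral_const_mul (ENNReal.ofReal (T * C)) hab.measurable_coeffInt_state).trans_lt
          (ENNReal.mul_lt_top ENNReal.ofReal_lt_top hN))
      change ‖T * _‖ₑ ≤ _
      rw [enorm_mul, Real.enorm_of_nonneg hT.le, ENNReal.ofReal_mul hT.le, mul_assoc]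
      gcongr
      exact enorm_integral_Lop_le (fun i x => (hC x).2.1 i) (fun i j x => (hC x).2.2 i j) hC0 _ _
  refine ⟨⟨γ, inferInstance⟩, ?_, hvel, hN⟩
  rintro φ v ⟨m, hm⟩ hφ1
  obtain ⟨f, hf, hφ, hv⟩ := hm (m + 1) (Nat.le_succ m)
  let e : SP d → Fin m → ℝ := fun μ k => ∫ x, g k x ∂μ.1
  let H : unitInterval × SP d → Fin m → ℝ := fun z k => stateVel T a b g (k + 1) z
  let F : ℝ × (Fin m → ℝ) → ℝ := fun q => f (Fin.cons q.1 q.2)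
  let c : ℝ × (Fin m → ℝ) →L[ℝ] (Fin (m + 1) → ℝ) := (Fin.consEquivL ℝ fun _ : Fin (m + 1) => ℝ)
  have hcons : ∀ z : unitInterval × SP d,
      (fun k : Fin (m + 1) => stateCoord g k z) = Fin.cons (z.1 : ℝ) (e z.2) := fun z => by
    ext k
    refine Fin.cases ?_ (fun k => ?_) k <;> simp [stateCoord, e]
  have hconsB : ∀ z : unitInterval × SP d,
      (fun k : Fin (m + 1) => stateVel T a b g k z) = Fin.cons (1 : ℝ) (H z) := fun z => by
    ext k
    refine Fin.cases ?_ (fun k => ?_) k <;> simp [stateVel, H]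
  have hF : ContDiff ℝ 3 F := hf.comp c.contDiff
  have hdF : ∀ q w, fderiv ℝ F q w = fderiv ℝ f (Fin.cons q.1 q.2) (Fin.cons w.1 w.2) := by
    intro q w
    have := ((hf.differentiable (by norm_num) (c q)).hasFDerivAt.comp q c.hasFDerivAt).fderiv
    change fderiv ℝ (f ∘ c) q w = _
    rw [this]
    rfl
  obtain ⟨R, hR⟩ := hg.exists_norm_le m
  have hec : Continuous e := continuous_pi fun k => hg.continuous_integral k
  have hHi : Integrable H γ := Integrable.of_eval fun k => hvel _
  have key := integral_fderiv_time_dependent (γ := γ) (Γ := fun θ => Γ (T * θ))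
    (e := e) hec.measurable.stronglyMeasurable hR hHi hF ?_ μ₀ ?_ ?_
  · calc ∫ z, v z ∂γ = ∫ z, fderiv ℝ F ((z.1 : ℝ), e z.2) (1, H z) ∂γ := by
          refine integral_congr_ae (Eventually.of_forall fun z => ?_)
          simp only [hv, hcons, hconsB, hdF]
      _ = - F (0, e μ₀) := key
      _ = - φ (0, μ₀) := by simp only [hφ, hcons, F, Set.Icc.coe_zero]
  · intro μ
    have := hφ1 (1, μ) (by simp [stateCoord])
    rw [hφ, hcons] at this
    simpa using this
  · intro h hh θ hθ
    have hθT : T * θ ∈ Set.Icc 0 T := mul_unitInterval_mem hT ⟨θ, hθ⟩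
    have hce := hΓ.eq_of_contDiff hg hh hθT
    rw [h0, integral_dirac' (Fof g h) _ (hh.continuous.comp hec).measurable.stronglyMeasurable,
      sub_eq_iff_eq_add'] at hce
    change ∫ μ, Fof g h μ ∂Γ (T * θ) = _
    rw [hce]
    congr 1
    have hscale := intervalIntegral.smul_integral_comp_mul_left (a := 0) (b := θ)
      (fun s => ∫ μ, bL a b g h s μ ∂Γ s) T
    rw [mul_zero] at hscale
    rw [← hscale, Measure.integral_compProd]
    · have h1 : ∀ s : unitInterval, (∫ μ, (if ((s, μ).1 : ℝ) ≤ θ then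
          fderiv ℝ h (e (s, μ).2) (H (s, μ)) else 0) ∂κ s) = (Set.Iic θ).indicator
          (fun s => T * ∫ μ, bL a b g h (T * s) μ ∂Γ (T * s)) (s : ℝ) := by
        intro s
        by_cases hs : (s : ℝ) ≤ θ
        · simp only [hs, if_true, Set.indicator_of_mem (Set.mem_Iic.2 hs), hκΓ]
          rw [← integral_const_mul]
          refine integral_congr_ae (Eventually.of_forall fun μ => ?_)
          simp only [bL_eq_fderiv]
          rw [← smul_eq_mul, ← map_smul]
          rfl
        · simp [hs]
      simp only [h1]
      rw [integral_unitInterval_coe, setIntegral_indicator measurableSet_Iic,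
        Set.Ioc_inter_Iic, min_eq_right hθ.2, integral_const_mul,
        intervalIntegral.integral_of_le hθ.1, smul_eq_mul]
    · have hec' : Continuous fun q : (Fin m → ℝ) × (Fin m → ℝ) => fderiv ℝ h q.1 q.2 :=
        ((hh.continuous_fderiv (by norm_num)).comp continuous_fst).clm_apply continuous_snd
      obtain ⟨C, hC⟩ := (isCompact_closedBall (0 : Fin m → ℝ) R).exists_bound_of_continuousOn
        (hh.continuous_fderiv (by norm_num)).continuousOn
      have hms : MeasurableSet {z : unitInterval × SP d | (z.1 : ℝ) ≤ θ} :=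
        measurableSet_le (measurable_subtype_coe.comp measurable_fst) measurable_const
      refine Integrable.indicator (f := fun z : unitInterval × SP d => fderiv ℝ h (e z.2) (H z)) ?_
          hms
      refine (hHi.norm.const_mul C).mono' (hec'.comp_aestronglyMeasurable
        ((hec.measurable.comp measurable_snd).aestronglyMeasurable.prodMk hHi.aestronglyMeasurable))
        (Eventually.of_forall fun z => ?_)
      refine (ContinuousLinearMap.le_opNorm _ _).trans ?_
      exact mul_le_mul_of_nonneg_right (hC _ (by simpa using hR z.2)) (norm_nonneg _)
  · intro p hp
    obtain ⟨C, hC⟩ := ((isCompact_Icc (a := (0 : ℝ)) (b := 1)).prod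
      (isCompact_closedBall (0 : Fin m → ℝ) R)).exists_bound_of_continuousOn hp.continuousOn
    rw [Measure.integral_compProd]
    · simp only [hκΓ]
      exact integral_unitInterval_coe fun θ => ∫ μ, p (θ, e μ) ∂Γ (T * θ)
    · refine (integrable_const C).mono' (hp.measurable.comp ((measurable_subtype_coe.comp
        measurable_fst).prodMk (hec.measurable.comp measurable_snd))).aestronglyMeasurable
        (Eventually.of_forall fun z => hC _ ⟨z.1.2, by simpa using hR z.2⟩)

end

section
variable {d : ℕ} {T : ℝ} {a : ℝ → SP d → Rd d → Fin d → Fin d → ℝ}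
  {b : ℝ → SP d → Rd d → Fin d → ℝ} {g : ℕ → Rd d → ℝ} {Γ : ℝ → Measure (SP d)}

lemma IsSPCESolution.exists_curve (hΓ : IsSPCESolution d T a b g Γ) (hT : 0 < T)
    (hab : GoodCoeffs d a b) (hg : GFamily d g) {μ₀ : SP d} (h0 : Γ 0 = Measure.dirac μ₀) :
    ∃ ρ : ℝ → SP d, Continuous ρ ∧ ρ 0 = μ₀ ∧
      ∫⁻ t in Set.Ioc 0 T, coeffInt a b t (ρ t) < ⊤ ∧
      ∀ k, ∀ t ∈ Set.Icc 0 T, NLFPKEq d a b ρ (g k) t := by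
  have := hg.metrizableSpace
  let _ : MetricSpace (SP d) := TopologicalSpace.metrizableSpaceMetric (SP d)
  have : SecondCountableTopology (SP d) := EMetric.secondCountable_of_sigmaCompact _
  obtain ⟨γ, hγ, hvel, hN⟩ := hΓ.exists_isSol hT hab hg h0
  obtain ⟨ζ, hζ, hζ0, hζ1, hζN, hζB⟩ := exists_integralCurve (E := stateCoord g)
    (B := stateVel T a b g) (fun k => by
      cases k with
      | zero => exact continuous_subtype_val.comp continuous_fst
      | succ k => exact (hg.continuous_integral k).comp continuous_snd)
    (hab.measurable_stateVel hg) (fun z => rfl) (fun z => z.1.2.1) (fun z => z.1.2.2)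
    (fun z z' h => Prod.ext (Subtype.ext (h 0)) (hg.ext fun k => h (k + 1))) (0, μ₀) rfl
    hab.measurable_coeffInt_state γ hγ hvel hN
  have hfst : ∀ s ∈ Set.Icc (0 : ℝ) 1, ((ζ s).1 : ℝ) = s := hζ1
  refine ⟨fun t => (ζ (t / T)).2, continuous_snd.comp (hζ.comp (by fun_prop)), by simp [hζ0], ?_,
    fun k t ht => ?_⟩
  · rw [← lintegral_Ioc_comp_mul_left hT fun t => coeffInt a b t (ζ (t / T)).2]
    refine ENNReal.mul_lt_top ENNReal.ofReal_lt_top (lt_of_eq_of_lt ?_ hζN)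
    refine setLIntegral_congr_fun measurableSet_Ioc fun s hs => ?_
    simp only [mul_div_cancel_left₀ _ hT.ne', hfst s (Set.Ioc_subset_Icc_self hs)]
  · have htT : t / T ∈ Set.Icc (0 : ℝ) 1 :=
      ⟨div_nonneg ht.1 hT.le, (div_le_one hT).2 ht.2⟩
    have h := (hζB (k + 1)).2 _ htT
    have hscale := intervalIntegral.smul_integral_comp_mul_left (a := 0) (b := t / T)
      (fun s => ∫ x, Lop a b s (ζ (s / T)).2 (g k) x ∂(ζ (s / T)).2.1) T
    rw [mul_zero, mul_div_cancel₀ _ hT.ne'] at hscale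
    rw [NLFPKEq, ← hscale, zero_div, hζ0, sub_eq_iff_eq_add', smul_eq_mul,
      ← intervalIntegral.integral_const_mul]
    refine h.trans ?_
    congr 1
    refine intervalIntegral.integral_congr fun s hs => ?_
    rw [Set.uIcc_of_le htT.1] at hs
    simp only [stateVel, mul_div_cancel_left₀ _ hT.ne', hfst s ⟨hs.1, hs.2.trans htT.2⟩]

lemma nlfpkEq_of_tendsto [HasOuterApproxClosed (SP d)] (hab : GoodCoeffs d a b) {ρ : ℝ → SP d}
    (hρ : Continuous ρ) (hN : ∫⁻ t in Set.Ioc 0 T, coeffInt a b t (ρ t) < ⊤)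
    {φ : ℕ → Rd d → ℝ} {ψ : Rd d → ℝ} {M C : ℝ} (hC : 0 ≤ C) (hφ : ∀ n, IsC2c (φ n))
    (hM : ∀ n x, |φ n x| ≤ M) (h1 : ∀ n i x, |pd (φ n) i x| ≤ C)
    (h2 : ∀ n i j x, |pd2 (φ n) i j x| ≤ C) (hlim : ∀ x, Tendsto (φ · x) atTop (𝓝 (ψ x)))
    (hlim1 : ∀ i x, Tendsto (fun n => pd (φ n) i x) atTop (𝓝 (pd ψ i x)))
    (hlim2 : ∀ i j x, Tendsto (fun n => pd2 (φ n) i j x) atTop (𝓝 (pd2 ψ i j x)))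
    {t : ℝ} (ht : t ∈ Set.Icc 0 T) (heq : ∀ n, NLFPKEq d a b ρ (φ n) t) :
    NLFPKEq d a b ρ ψ t := by
  have hint : ∀ μ : SP d, Tendsto (fun n => ∫ x, φ n x ∂μ.1) atTop (𝓝 (∫ x, ψ x ∂μ.1)) := fun μ =>
    tendsto_integral_of_dominated_convergence (fun _ => M)
      (fun n => (hφ n).1.continuous.aestronglyMeasurable) (integrable_const M)
      (fun n => Eventually.of_forall (hM n)) (Eventually.of_forall hlim)
  have hLop : ∀ s (μ : SP d) x,
      Tendsto (fun n => Lop a b s μ (φ n) x) atTop (𝓝 (Lop a b s μ ψ x)) := fun s μ x =>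
    (tendsto_finsetSum _ fun i _ => tendsto_finsetSum _ fun j _ => (hlim2 i j x).const_mul _).add
      (tendsto_finsetSum _ fun i _ => (hlim1 i x).const_mul _)
  have hmeas : Measurable fun s => (s, ρ s) := measurable_id.prodMk hρ.measurable
  have hfin : ∀ᵐ s ∂volume.restrict (Set.Ioc 0 T), coeffInt a b s (ρ s) < ⊤ :=
    ae_lt_top (hab.measurable_coeffInt.comp hmeas) hN.ne
  have hsub : Set.uIoc 0 t ⊆ Set.Ioc 0 T := by
    rw [Set.uIoc_of_le ht.1]
    exact Set.Ioc_subset_Ioc_right ht.2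
  have hfin' : ∀ᵐ s, s ∈ Set.uIoc 0 t → coeffInt a b s (ρ s) < ⊤ := by
    filter_upwards [(ae_restrict_iff' measurableSet_Ioc).1 hfin] with s hs hst
    exact hs (hsub hst)
  refine tendsto_nhds_unique ((hint (ρ t)).sub (hint (ρ 0))) (Tendsto.congr (fun n => (heq n).symm)
      ?_)
  refine intervalIntegral.tendsto_integral_filter_of_dominated_convergence
    (fun s => C * (coeffInt a b s (ρ s)).toReal) (Eventually.of_forall fun n => ?_)
    (Eventually.of_forall fun n => ?_) ?_ ?_
  · exact ((hab.measurable_integral_Lop (hφ n).1).comp hmeas).aestronglyMeasurable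
  · filter_upwards [hfin'] with s hs hst
    have h := enorm_integral_Lop_le (a := a) (b := b) (h1 n) (h2 n) hC s (ρ s)
    rw [← toReal_enorm, ← ENNReal.toReal_ofReal hC, ← ENNReal.toReal_mul]
    exact ENNReal.toReal_mono (ENNReal.mul_ne_top ENNReal.ofReal_ne_top (hs hst).ne) h
  · rw [intervalIntegrable_iff]
    exact (IntegrableOn.mono_set (integrable_toReal_of_lintegral_ne_top
      (hab.measurable_coeffInt.comp hmeas).aemeasurable hN.ne) hsub).const_mul C
  · filter_upwards [hfin'] with s hs hst
    exact tendsto_integral_of_dominated_convergence (fun x => C * coeffNorm a b s (ρ s) x)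
      (fun n => (measurable_slice (hab.measurable_Lop (hφ n).1) s (ρ s)).aestronglyMeasurable)
      ((hab.integrable_coeffNorm (hs hst)).const_mul C)
      (fun n => Eventually.of_forall fun x => abs_Lop_le (fun i => h1 n i x) (fun i j => h2 n i j x)
          _ _)
      (Eventually.of_forall (hLop s (ρ s)))

lemma tendsto_of_abs_sub_le_inv {u : ℕ → ℝ} {l : ℝ} (h : ∀ n : ℕ, |u n - l| ≤ ((n : ℝ) + 1)⁻¹) :
    Tendsto u atTop (𝓝 l) :=
  tendsto_iff_dist_tendsto_zero.2 (squeeze_zero (fun _ => dist_nonneg) h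
    (by simpa using tendsto_one_div_add_atTop_nhds_zero_nat (𝕜 := ℝ)))

lemma nlfpkEq_of_gFamily [HasOuterApproxClosed (SP d)] (hab : GoodCoeffs d a b) (hg : GFamily d g)
    {ρ : ℝ → SP d} (hρ : Continuous ρ) (hN : ∫⁻ t in Set.Ioc 0 T, coeffInt a b t (ρ t) < ⊤)
    {t : ℝ} (ht : t ∈ Set.Icc 0 T) (heq : ∀ k, NLFPKEq d a b ρ (g k) t) {φ : Rd d → ℝ}
    (hφ : IsC2c φ) : NLFPKEq d a b ρ φ t := by
  choose k hk using fun n : ℕ => hg.2.2 φ hφ ((n : ℝ) + 1)⁻¹ (by positivity)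
  obtain ⟨-, M, hM⟩ := hφ.isC2b
  have hM0 : 0 ≤ M := (abs_nonneg _).trans (hM 0).1
  have hle : ∀ (n : ℕ) {u l : ℝ}, |u - l| ≤ ((n : ℝ) + 1)⁻¹ → |l| ≤ M → |u| ≤ M + 1 := by
    intro n u l h hl
    have h1 : ((n : ℝ) + 1)⁻¹ ≤ 1 := inv_le_one_of_one_le₀ (by linarith [n.cast_nonneg (α := ℝ)])
    have := abs_sub_abs_le_abs_sub u l
    linarith
  exact nlfpkEq_of_tendsto hab hρ hN (φ := fun n => g (k n)) (M := M + 1) (C := M + 1)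
    (by linarith) (fun n => hg.1 _) (fun n x => hle n ((hk n).1 x) (hM x).1)
    (fun n i x => hle n ((hk n).2.1 i x) ((hM x).2.1 i))
    (fun n i j x => hle n ((hk n).2.2 i j x) ((hM x).2.2 i j))
    (fun x => tendsto_of_abs_sub_le_inv fun n => (hk n).1 x)
    (fun i x => tendsto_of_abs_sub_le_inv fun n => (hk n).2.1 i x)
    (fun i j x => tendsto_of_abs_sub_le_inv fun n => (hk n).2.2 i j x) ht fun n => heq _

lemma pd_comp_smul {n : ℕ} (f : (Fin n → ℝ) → ℝ) (c : ℝ) (i : Fin n) (x : Fin n → ℝ) :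
    pd (fun y => f (c • y)) i x = c * pd f i (c • x) := by
  rw [pd, fderiv_comp_smul]
  rfl

lemma pd2_comp_smul {n : ℕ} (f : (Fin n → ℝ) → ℝ) (c : ℝ) (i j : Fin n) (x : Fin n → ℝ) :
    pd2 (fun y => f (c • y)) i j x = c * (c * pd2 f i j (c • x)) := by
  change pd (fun y => pd (fun z => f (c • z)) j y) i x = _
  simp only [pd_comp_smul f c j]
  change fderiv ℝ (c • fun y => pd f j (c • y)) x _ = _
  rw [fderiv_const_smul_field]
  exact congrArg (c * ·) (pd_comp_smul (pd f j) c i x)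

lemma exists_cutoff_bound (d : ℕ) : ∃ C, 0 ≤ C ∧ ∀ n x, (∀ i, |pd (cutoff d n) i x| ≤ C) ∧
    ∀ i j, |pd2 (cutoff d n) i j x| ≤ C := by
  obtain ⟨-, C, hC⟩ := IsC2c.isC2b (n := d) ⟨contDiff_bump (n := 2), hasCompactSupport_bump⟩
  have hC0 : 0 ≤ C := (abs_nonneg _).trans (hC 0).1
  have hc : ∀ (n : ℕ) {u : ℝ}, |u| ≤ C → |((n : ℝ) + 1)⁻¹ * u| ≤ C := fun n u hu => by
    rw [abs_mul, abs_of_nonneg (by positivity)]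
    exact (mul_le_of_le_one_left (abs_nonneg _)
      (inv_le_one_of_one_le₀ (by linarith [n.cast_nonneg (α := ℝ)]))).trans hu
  refine ⟨C, hC0, fun n x => ⟨fun i => ?_, fun i j => ?_⟩⟩
  · exact (pd_comp_smul (bump d) _ i x).symm ▸ hc n ((hC _).2.1 i)
  · exact (pd2_comp_smul (bump d) _ i j x).symm ▸ hc n (hc n ((hC _).2.2 i j))

lemma eventually_cutoff_eventuallyEq_one (x : Rd d) :
    ∀ᶠ n in atTop, cutoff d n =ᶠ[𝓝 x] fun _ => 1 := by
  obtain ⟨n₀, hn₀⟩ := exists_nat_ge ‖x‖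
  filter_upwards [eventually_ge_atTop n₀] with n hn
  have h : (n₀ : ℝ) ≤ n := by exact_mod_cast hn
  have hlt : ‖x‖ < (n : ℝ) + 1 := by linarith
  filter_upwards [(isOpen_lt continuous_norm continuous_const).mem_nhds hlt] with y hy
  have hy : ‖y‖ < (n : ℝ) + 1 := hy
  rw [cutoff, bump_eq_one]
  rw [norm_smul, norm_inv, Real.norm_of_nonneg (by positivity), inv_mul_le_one₀ (by positivity)]
  exact hy.le

lemma pd_congr_of_eventuallyEq {n : ℕ} {f h : (Fin n → ℝ) → ℝ} {x : Fin n → ℝ} (hfh : f =ᶠ[𝓝 x] h)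
    (i : Fin n) : pd f i =ᶠ[𝓝 x] pd h i :=
  hfh.fderiv.fun_comp fun L => L (Pi.single i 1)

lemma measure_univ_eq_one_of_nlfpkEq [HasOuterApproxClosed (SP d)] (hab : GoodCoeffs d a b)
    {ρ : ℝ → SP d} (hρ : Continuous ρ) (hN : ∫⁻ t in Set.Ioc 0 T, coeffInt a b t (ρ t) < ⊤)
    {t : ℝ} (ht : t ∈ Set.Icc 0 T) (heq : ∀ φ, IsC2c φ → NLFPKEq d a b ρ φ t)
    (h0 : (ρ 0).1 Set.univ = 1) : (ρ t).1 Set.univ = 1 := by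
  obtain ⟨C, hC0, hC⟩ := exists_cutoff_bound d
  have h := nlfpkEq_of_tendsto hab hρ hN (φ := cutoff d) (ψ := fun _ => 1) (M := 1) hC0 isC2c_cutoff
    (fun n x => (abs_of_nonneg (bump_nonneg _)).trans_le (bump_le_one _))
    (fun n i x => (hC n x).1 i) (fun n i j x => (hC n x).2 i j)
    (fun x => tendsto_nhds_of_eventually_eq (tendsto_cutoff x))
    (fun i x => tendsto_nhds_of_eventually_eq ((eventually_cutoff_eventuallyEq_one x).mono
      fun n hn => (pd_congr_of_eventuallyEq hn i).self_of_nhds))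
    (fun i j x => tendsto_nhds_of_eventually_eq ((eventually_cutoff_eventuallyEq_one x).mono
      fun n hn => (pd_congr_of_eventuallyEq (pd_congr_of_eventuallyEq hn j) i).self_of_nhds))
    ht fun n => heq _ (isC2c_cutoff n)
  have hpd : ∀ i x, pd (fun _ : Rd d => (1 : ℝ)) i x = 0 := fun i x => by simp [pd]
  have hpd2 : ∀ i j x, pd2 (fun _ : Rd d => (1 : ℝ)) i j x = 0 := fun i j x => by simp [pd2, hpd]
  simp only [NLFPKEq, Lop, hpd, hpd2, mul_zero, Finset.sum_const_zero, add_zero, integral_zero,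
    intervalIntegral.integral_zero, integral_const, smul_eq_mul, mul_one, Measure.real, h0,
    ENNReal.toReal_one, sub_eq_zero] at h
  rwa [ENNReal.toReal_eq_one_iff] at h

lemma weaklyContinuousOn_of_measure_univ_eq_one {ρ : ℝ → SP d} (hρ : Continuous ρ) {S : Set ℝ}
    (h1 : ∀ t ∈ S, (ρ t).1 Set.univ = 1) : WeaklyContinuousOn ρ S := by
  rintro f hf ⟨M, hM⟩ t₀ ht₀
  have hM0 : 0 ≤ M := (abs_nonneg _).trans (hM 0)
  have hcut : ∀ n, Continuous fun t => ∫ x, cutoff d n x ∂(ρ t).1 := fun n =>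
    (SP.continuous_integral (isC2c_cutoff n).1.continuous (isC2c_cutoff n).2).comp hρ
  have hfi : ∀ μ : SP d, Integrable f μ.1 := fun μ =>
    (integrable_const M).mono' hf.aestronglyMeasurable (Eventually.of_forall hM)
  have hfc : ∀ n, Continuous fun x => cutoff d n x * f x := fun n =>
    (isC2c_cutoff n).1.continuous.mul hf
  refine continuousWithinAt_of_locally_uniform_approx_of_continuousWithinAt ht₀ fun u hu => ?_
  obtain ⟨ε, hε, hεu⟩ := Metric.mem_uniformity_dist.1 hu
  have hlim : Tendsto (fun n => M * (1 - ∫ x, cutoff d n x ∂(ρ t₀).1)) atTop (𝓝 0) := by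
    have : Tendsto (fun n => ∫ x, cutoff d n x ∂(ρ t₀).1) atTop (𝓝 (∫ x, 1 ∂(ρ t₀).1)) :=
      tendsto_integral_of_dominated_convergence (fun _ => 1)
        (fun n => (isC2c_cutoff n).1.continuous.aestronglyMeasurable) (integrable_const _)
        (fun n => Eventually.of_forall fun x => (abs_of_nonneg (bump_nonneg _)).trans_le
            (bump_le_one _))
        (Eventually.of_forall fun x => tendsto_nhds_of_eventually_eq (tendsto_cutoff x))
    simpa [Measure.real, h1 t₀ ht₀] using (this.const_sub 1).const_mul M
  obtain ⟨n, hn⟩ := (hlim.eventually_lt_const hε).exists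
  have hev : ∀ᶠ t in 𝓝[S] t₀, t ∈ S ∧ M * (1 - ∫ x, cutoff d n x ∂(ρ t).1) < ε :=
    eventually_mem_nhdsWithin.and (mem_nhdsWithin_of_mem_nhds
      ((isOpen_lt (continuous_const.mul (continuous_const.sub (hcut n))) continuous_const).mem_nhds
          hn))
  refine ⟨_, hev, fun t => ∫ x, cutoff d n x * f x ∂(ρ t).1,
    ((SP.continuous_integral (hfc n) (isC2c_cutoff n).2.mul_right).comp hρ).continuousWithinAt,
    fun t ht => hεu (lt_of_le_of_lt ?_ ht.2)⟩
  have hci := (ρ t).integrable_of_compactSupport (isC2c_cutoff n).1.continuous (isC2c_cutoff n).2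
  have hcfi := (ρ t).integrable_of_compactSupport (hfc n) (isC2c_cutoff n).2.mul_right
  have hone : ∫ _, (1 : ℝ) ∂(ρ t).1 = 1 := by simp [Measure.real, h1 t ht.1]
  conv_rhs => rw [← hone]
  rw [Real.dist_eq, ← integral_sub (hfi _) hcfi, ← integral_sub (integrable_const _) hci,
    ← integral_const_mul, ← Real.norm_eq_abs]
  refine norm_integral_le_of_norm_le (((integrable_const _).sub hci).const_mul M)
    (Eventually.of_forall fun x => ?_)
  have : f x - cutoff d n x * f x = f x * (1 - cutoff d n x) := by ring
  have hc : 0 ≤ 1 - cutoff d n x := sub_nonneg.2 (bump_le_one _)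
  rw [this, norm_mul, Real.norm_of_nonneg hc]
  exact mul_le_mul_of_nonneg_right (hM x) hc

lemma IsSPCESolution.exists_isSubprobSolution (hΓ : IsSPCESolution d T a b g Γ) (hT : 0 < T)
    (hab : GoodCoeffs d a b) (hg : GFamily d g) {μ₀ : SP d} (h0 : Γ 0 = Measure.dirac μ₀) :
    ∃ ρ : ℝ → SP d, IsSubprobSolution d T a b ρ ∧ ρ 0 = μ₀ ∧
      (μ₀.1 Set.univ = 1 → IsProbSolution d T a b ρ) := by
  obtain ⟨ρ, hρ, hρ0, hN, heq⟩ := hΓ.exists_curve hT hab hg h0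
  have := hg.metrizableSpace
  let _ : MetricSpace (SP d) := TopologicalSpace.metrizableSpaceMetric (SP d)
  have hφ : ∀ φ, IsC2c φ → ∀ t ∈ Set.Icc 0 T, NLFPKEq d a b ρ φ t := fun φ hφ t ht =>
    nlfpkEq_of_gFamily hab hg hρ hN ht (fun k => heq k t ht) hφ
  have hsub : IsSubprobSolution d T a b ρ := by
    refine ⟨hρ.continuousOn, fun i j => lt_of_le_of_lt ?_ hN, hφ⟩
    refine lintegral_mono fun t => lintegral_mono fun x => ENNReal.ofReal_le_ofReal ?_
    rw [add_comm]
    exact add_le_add (Finset.single_le_sum (f := fun i => |b t (ρ t) x i|)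
      (fun _ _ => abs_nonneg _) (Finset.mem_univ i))
      ((Finset.single_le_sum (f := fun j => |a t (ρ t) x i j|)
        (fun _ _ => abs_nonneg _) (Finset.mem_univ j)).trans
      (Finset.single_le_sum (f := fun i => ∑ j, |a t (ρ t) x i j|)
        (fun _ _ => Finset.sum_nonneg fun _ _ => abs_nonneg _) (Finset.mem_univ i)))
  refine ⟨ρ, hsub, hρ0, fun hμ₀ => ?_⟩
  have hmass : ∀ t ∈ Set.Icc 0 T, (ρ t).1 Set.univ = 1 := fun t ht =>
    measure_univ_eq_one_of_nlfpkEq hab hρ hN ht (fun φ h => hφ φ h t ht) (hρ0 ▸ hμ₀)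
  exact ⟨hsub, hmass, weaklyContinuousOn_of_measure_univ_eq_one hρ hmass⟩

end

/-- Corollary 3.8: existence of a solution to (SP-CE) started at `δ_{μ₀}`
implies existence of a subprobability solution to (NLFPK) started at `μ₀`; if `μ₀` is a
probability measure, there is a probability solution. -/
theorem existence_transfer_SPCE_to_NLFPK (d : ℕ) (T : ℝ) (hT : 0 < T)
    (a : ℝ → SP d → Rd d → Fin d → Fin d → ℝ) (b : ℝ → SP d → Rd d → Fin d → ℝ)
    (hab : GoodCoeffs d a b) (g : ℕ → Rd d → ℝ) (hg : GFamily d g)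
    (μ₀ : SP d)
    (hexists : ∃ Γ : ℝ → Measure (SP d),
      IsSPCESolution d T a b g Γ ∧ Γ 0 = Measure.dirac μ₀) :
    (∃ μ : ℝ → SP d, IsSubprobSolution d T a b μ ∧ μ 0 = μ₀) ∧
      (μ₀.1 Set.univ = 1 → ∃ μ : ℝ → SP d, IsProbSolution d T a b μ ∧ μ 0 = μ₀) := by
  obtain ⟨Γ, hΓ, h0⟩ := hexists
  obtain ⟨ρ, h, hρ, hp⟩ := hΓ.exists_isSubprobSolution hT hab hg h0
  exact ⟨⟨ρ, h, hρ⟩, fun hμ => ⟨ρ, hp hμ, hρ⟩⟩
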